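/- arXiv:math/9406207 — 3 statements merged into one kernel-verified Lean document; each statement's English description precedes it below -/
import Mathlib

section
/- Let G be the group with presentation ⟨a, b | a^6 = 1, b^6 = 1, a·b^2 = b·a^2⟩. Then the quotient G'/G'' of the first derived subgroup of G by the second derived subgroup of G is isomorphic to C_4 × C_4, the direct product of two cyclic groups of order 4. -/
/-- The relators of the presentation ⟨a, b | a^6 = 1, b^6 = 1, a·b^2 = b·a^2⟩. -/
def G2rels : Set (FreeGroup (Fin 2)) :=
  {(FreeGroup.of 0) ^ 6, (FreeGroup.of 1) ^ 6,
   FreeGroup.of 0 * (FreeGroup.of 1) ^ 2 * (FreeGroup.of 1 * (FreeGroup.of 0) ^ 2)⁻¹}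

/-- The group G(2) = ⟨a, b | a^6 = b^6 = 1, ab^2 = ba^2⟩. -/
abbrev G2 : Type := PresentedGroup G2rels

namespace G2

open scoped commutatorElement

/-- The image of the generator `a` in `G2`. -/
def a : G2 := PresentedGroup.of 0

/-- The image of the generator `b` in `G2`. -/
def b : G2 := PresentedGroup.of 1

theorem a_pow_six : a ^ 6 = 1 :=
  PresentedGroup.one_of_mem (rels := G2rels) (x := FreeGroup.of 0 ^ 6) (by simp [G2rels])

theorem b_pow_six : b ^ 6 = 1 :=
  PresentedGroup.one_of_mem (rels := G2rels) (x := FreeGroup.of 1 ^ 6) (by simp [G2rels])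

theorem a_mul_b_sq : a * b ^ 2 = b * a ^ 2 :=
  mul_inv_eq_one.mp <| PresentedGroup.one_of_mem (rels := G2rels)
    (x := FreeGroup.of 0 * FreeGroup.of 1 ^ 2 * (FreeGroup.of 1 * FreeGroup.of 0 ^ 2)⁻¹)
    (by simp [G2rels])

theorem closure_a_b : Subgroup.closure {a, b} = (⊤ : Subgroup G2) := by
  rw [← PresentedGroup.closure_range_of G2rels]
  congr 1
  ext g
  simp [a, b, Fin.exists_fin_two, eq_comm]

/-- The conjugates of `b * a⁻¹` by the powers of `a`. -/
def x (n : ℕ) : G2 := a ^ n * (b * a⁻¹) * (a ^ n)⁻¹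

theorem x_zero_mul_a : x 0 * a = b := by simp [x]

theorem conj_a_x (n : ℕ) : a * x n * a⁻¹ = x (n + 1) := by
  simp only [x, pow_succ']
  group

theorem x_succ_mul (n : ℕ) : x (n + 1) * x (n + 2) = x n := by
  have h : a * b ^ 2 * (a ^ 3)⁻¹ = b * a⁻¹ := by
    rw [a_mul_b_sq]
    group
  calc x (n + 1) * x (n + 2) = a ^ n * (a * b ^ 2 * (a ^ 3)⁻¹) * (a ^ n)⁻¹ := by
        simp [x, pow_succ, mul_assoc]
    _ = x n := by rw [h, x]

theorem x_prod (n : ℕ) :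
    x n * x (n + 1) * x (n + 2) * x (n + 3) * x (n + 4) * x (n + 5) = 1 := by
  calc x n * x (n + 1) * x (n + 2) * x (n + 3) * x (n + 4) * x (n + 5)
      = a ^ n * (b ^ 6 * (a ^ 6)⁻¹) * (a ^ n)⁻¹ := by
        simp [x, pow_succ, mul_assoc]
    _ = 1 := by simp [a_pow_six, b_pow_six]

theorem x_mem_closure (n : ℕ) : x n ∈ Subgroup.closure {x 0, x 1} := by
  induction n using Nat.twoStepInduction with
  | zero => exact Subgroup.subset_closure (by simp)
  | one => exact Subgroup.subset_closure (by simp)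
  | more n h₀ h₁ =>
    rw [eq_inv_mul_of_mul_eq (x_succ_mul n)]
    exact mul_mem (inv_mem h₁) h₀

theorem a_mem_normalizer :
    a ∈ Subgroup.normalizer (Subgroup.closure {x 0, x 1} : Set G2) := by
  set S := Subgroup.closure {x 0, x 1} with hS
  have hle (g : G2) (hg : g ∈ S) : a * g * a⁻¹ ∈ S := by
    suffices S ≤ S.comap (MulAut.conj a).toMonoidHom from this hg
    rw [hS, Subgroup.closure_le]
    rintro _ (rfl | rfl)
    · simpa [conj_a_x] using x_mem_closure 1
    · simpa [conj_a_x] using x_mem_closure 2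
  have hpow (n : ℕ) (g : G2) (hg : g ∈ S) : a ^ n * g * (a ^ n)⁻¹ ∈ S := by
    induction n with
    | zero => simpa using hg
    | succ n ih => simpa [pow_succ', mul_assoc] using hle _ ih
  rw [Subgroup.mem_normalizer_iff]
  refine fun g => ⟨hle g, fun hg => ?_⟩
  have h := hpow 5 _ hg
  have he : a ^ 5 * (a * g * a⁻¹) * (a ^ 5)⁻¹ = a ^ 6 * g * (a ^ 6)⁻¹ := by group
  simpa [he, a_pow_six] using h

instance normal_closure_x : (Subgroup.closure {x 0, x 1}).Normal := by
  rw [← Subgroup.normalizer_eq_top_iff, eq_top_iff, ← closure_a_b, Subgroup.closure_le]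
  rintro _ (rfl | rfl)
  · exact a_mem_normalizer
  · rw [← x_zero_mul_a]
    exact mul_mem (Subgroup.le_normalizer (x_mem_closure 0)) a_mem_normalizer

theorem commutator_eq_closure : commutator G2 = Subgroup.closure {x 0, x 1} := by
  apply le_antisymm
  · set S := Subgroup.closure {x 0, x 1} with hS
    let π : G2 →* G2 ⧸ S := QuotientGroup.mk' S
    have hab : π b = π a := by
      rw [← x_zero_mul_a, map_mul, mul_eq_right]
      exact (QuotientGroup.eq_one_iff _).mpr (x_mem_closure 0)
    have hrange (g : G2) : π g ∈ Subgroup.zpowers (π a) := by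
      suffices (⊤ : Subgroup G2) ≤ (Subgroup.zpowers (π a)).comap π from this trivial
      rw [← closure_a_b, Subgroup.closure_le]
      rintro _ (rfl | rfl)
      · exact Subgroup.mem_zpowers _
      · simp [hab]
    rw [commutator_def, Subgroup.commutator_le]
    intro g _ h _
    obtain ⟨m, hm⟩ := hrange g
    obtain ⟨n, hn⟩ := hrange h
    refine (QuotientGroup.eq_one_iff _).mp ?_
    change π ⁅g, h⁆ = 1
    rw [map_commutatorElement, commutatorElement_eq_one_iff_commute, ← hm, ← hn]
    exact (Commute.refl _).zpow_zpow m n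
  · have hx : x 0 ∈ commutator G2 := by
      have h := congrArg Abelianization.of a_mul_b_sq
      rw [map_mul, map_mul, map_pow, map_pow, sq, sq, ← mul_assoc, ← mul_assoc,
        mul_comm (Abelianization.of a), mul_right_inj] at h
      rw [← Abelianization.ker_of, MonoidHom.mem_ker]
      simp [x, h]
    rw [Subgroup.closure_le]
    rintro _ (rfl | rfl)
    · exact hx
    · rw [← conj_a_x 0]
      exact Subgroup.Normal.conj_mem inferInstance _ hx a

theorem x_mem_commutator (n : ℕ) : x n ∈ commutator G2 :=
  commutator_eq_closure ▸ x_mem_closure n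

/-- The class of `x n` in the abelianization of the derived subgroup. -/
def y (n : ℕ) : Abelianization (commutator G2) :=
  Abelianization.of ⟨x n, x_mem_commutator n⟩

theorem y_succ_mul (n : ℕ) : y (n + 1) * y (n + 2) = y n := by
  simp only [y, ← map_mul]
  exact congrArg _ (Subtype.ext (x_succ_mul n))

theorem y_prod (n : ℕ) :
    y n * y (n + 1) * y (n + 2) * y (n + 3) * y (n + 4) * y (n + 5) = 1 := by
  simp only [y, ← map_mul]
  exact (congrArg _ (Subtype.ext (x_prod n))).trans (map_one _)

theorem y_succ_pow_four (n : ℕ) : y (n + 1) ^ 4 = 1 := by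
  have h₀ : y n = y (n + 1) * y (n + 2) := (y_succ_mul n).symm
  have h₁ : y (n + 1) = y (n + 2) * y (n + 3) := (y_succ_mul (n + 1)).symm
  have h₂ : y (n + 2) = y (n + 3) * y (n + 4) := (y_succ_mul (n + 2)).symm
  have h₃ : y (n + 3) = y (n + 4) * y (n + 5) := (y_succ_mul (n + 3)).symm
  rw [← y_prod n, h₀, h₁, h₂, h₃]
  simp only [pow_succ, pow_zero, one_mul]
  ac_rfl

theorem y_pow_four (n : ℕ) : y n ^ 4 = 1 := by
  rw [← y_succ_mul, mul_pow, y_succ_pow_four, y_succ_pow_four, mul_one]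

theorem exists_zpow_mul_zpow (z : Abelianization (commutator G2)) :
    ∃ m n : ℤ, y 0 ^ m * y 1 ^ n = z := by
  rw [← Subgroup.mem_closure_pair]
  obtain ⟨⟨g, hg⟩, rfl⟩ := QuotientGroup.mk_surjective z
  change Abelianization.of _ ∈ _
  have hg' := hg
  rw [commutator_eq_closure] at hg'
  induction hg' using Subgroup.closure_induction with
  | mem g h =>
    obtain rfl | rfl := h
    · exact Subgroup.subset_closure (Or.inl rfl)
    · exact Subgroup.subset_closure (Or.inr rfl)
  | one => exact one_mem _
  | mul g h hg₁ hh₁ ihg ihh =>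
    rw [← commutator_eq_closure] at hg₁ hh₁
    exact mul_mem (ihg hg₁) (ihh hh₁)
  | inv g hg₁ ih =>
    rw [← commutator_eq_closure] at hg₁
    exact inv_mem (ih hg₁)

/-- The group `C₄ × C₄`. -/
abbrev M : Type := Multiplicative (ZMod 4) × Multiplicative (ZMod 4)

/-- The automorphism of `C₄ × C₄` describing conjugation by `a` in the basis `x 0`, `x 1`. -/
def shift : MulAut M where
  toFun p := (p.2, p.1 * p.2⁻¹)
  invFun p := (p.1 * p.2, p.1)
  left_inv p := by simp
  right_inv p := by simp
  map_mul' p q := by simp [mul_mul_mul_comm, mul_comm]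

theorem shift_pow_six : shift ^ 6 = 1 := MulEquiv.ext (by decide)

/-- The holomorph of `C₄ × C₄`. -/
abbrev Hol : Type := M ⋊[MonoidHom.id (MulAut M)] MulAut M

/-- The images of the generators of `G2` in the holomorph of `C₄ × C₄`. -/
def holGen : Fin 2 → Hol :=
  ![⟨1, shift⟩, ⟨(Multiplicative.ofAdd 1, 1), shift⟩]

theorem lift_holGen_eq_one (r : FreeGroup (Fin 2)) (hr : r ∈ G2rels) :
    FreeGroup.lift holGen r = 1 := by
  obtain rfl | rfl | rfl := hr
  · rw [map_pow, FreeGroup.lift_apply_of]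
    exact SemidirectProduct.ext (by decide) shift_pow_six
  · rw [map_pow, FreeGroup.lift_apply_of]
    exact SemidirectProduct.ext (by decide) shift_pow_six
  · rw [map_mul, map_inv, mul_inv_eq_one]
    simp only [map_mul, map_pow, FreeGroup.lift_apply_of]
    exact SemidirectProduct.ext (by decide) rfl

/-- The homomorphism from `G2` to the holomorph of `C₄ × C₄`. -/
def toHol : G2 →* Hol := PresentedGroup.toGroup lift_holGen_eq_one

theorem toHol_a : toHol a = ⟨1, shift⟩ := PresentedGroup.toGroup.of _

theorem toHol_b : toHol b = ⟨(Multiplicative.ofAdd 1, 1), shift⟩ := PresentedGroup.toGroup.of _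

theorem toHol_x_zero : toHol (x 0) = SemidirectProduct.inl (Multiplicative.ofAdd 1, 1) := by
  have h := congrArg toHol x_zero_mul_a
  rw [map_mul, ← eq_mul_inv_iff_mul_eq, toHol_a, toHol_b] at h
  rw [h, mul_inv_eq_iff_eq_mul]
  ext1 <;> simp

theorem toHol_x_one : toHol (x 1) = SemidirectProduct.inl (1, Multiplicative.ofAdd 1) := by
  rw [← conj_a_x 0, map_mul, map_mul, map_inv, toHol_x_zero, toHol_a, mul_inv_eq_iff_eq_mul]
  exact SemidirectProduct.ext (by decide) rfl

theorem toHol_right (g : commutator G2) : (toHol g).right = 1 := by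
  suffices commutator G2 ≤ (SemidirectProduct.rightHom.comp toHol).ker from this g.2
  rw [commutator_eq_closure, Subgroup.closure_le]
  rintro _ (rfl | rfl)
  · simp [toHol_x_zero]
  · simp [toHol_x_one]

/-- The translation part of `toHol`, a homomorphism on the derived subgroup. -/
def translation : commutator G2 →* M where
  toFun g := (toHol g).left
  map_one' := by simp
  map_mul' g h := by simp [toHol_right]

/-- The homomorphism from the abelianized derived subgroup to `C₄ × C₄`. -/
def abTranslation : Abelianization (commutator G2) →* M := Abelianization.lift translation

theorem abTranslation_y_zero : abTranslation (y 0) = (Multiplicative.ofAdd 1, 1) :=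
  congrArg SemidirectProduct.left toHol_x_zero

theorem abTranslation_y_one : abTranslation (y 1) = (1, Multiplicative.ofAdd 1) :=
  congrArg SemidirectProduct.left toHol_x_one

theorem abTranslation_zpow (m n : ℤ) : abTranslation (y 0 ^ m * y 1 ^ n) =
    (Multiplicative.ofAdd (m : ZMod 4), Multiplicative.ofAdd (n : ZMod 4)) := by
  simp [abTranslation_y_zero, abTranslation_y_one, ← ofAdd_zsmul]

theorem abTranslation_bijective : Function.Bijective abTranslation := by
  constructor
  · rw [injective_iff_map_eq_one]
    intro z hz
    obtain ⟨m, n, rfl⟩ := exists_zpow_mul_zpow z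
    rw [abTranslation_zpow, Prod.mk_eq_one, ofAdd_eq_one, ofAdd_eq_one,
      ZMod.intCast_zmod_eq_zero_iff_dvd, ZMod.intCast_zmod_eq_zero_iff_dvd] at hz
    obtain ⟨⟨m, rfl⟩, ⟨n, rfl⟩⟩ := hz
    simp [zpow_mul, zpow_ofNat, y_pow_four]
  · rintro ⟨p, q⟩
    obtain ⟨m, hm⟩ := ZMod.intCast_surjective p.toAdd
    obtain ⟨n, hn⟩ := ZMod.intCast_surjective q.toAdd
    exact ⟨y 0 ^ m * y 1 ^ n, by rw [abTranslation_zpow, hm, hn]; rfl⟩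

end G2

/-- G'\''/G'\'' ≅ C₄ × C₄: the abelianization of the derived subgroup G'\'' of G(2)
is the direct product of two cyclic groups of order 4. -/
theorem derived_quotient_G2 :
    Nonempty (Abelianization (commutator G2) ≃*
      Multiplicative (ZMod 4) × Multiplicative (ZMod 4)) :=
  ⟨MulEquiv.ofBijective G2.abTranslation G2.abTranslation_bijective⟩
end

section
/- Let G be the group with presentation ⟨a, b, c | a^6 = b^6 = c^6 = 1, ab^2 = ba^2, ac^2 = ca^2, bc^2 = cb^2⟩. Then the second derived subgroup G'' of G is free abelian of rank 9, i.e., isomorphic to ℤ^9, and in particular G is soluble of derived length exactly 3. -/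
/-- The relators of ⟨a, b, c | a^6 = b^6 = c^6 = 1, ab^2 = ba^2, ac^2 = ca^2, bc^2 = cb^2⟩. -/
def G3rels : Set (FreeGroup (Fin 3)) :=
  {(FreeGroup.of 0) ^ 6, (FreeGroup.of 1) ^ 6, (FreeGroup.of 2) ^ 6,
   FreeGroup.of 0 * (FreeGroup.of 1) ^ 2 * (FreeGroup.of 1 * (FreeGroup.of 0) ^ 2)⁻¹,
   FreeGroup.of 0 * (FreeGroup.of 2) ^ 2 * (FreeGroup.of 2 * (FreeGroup.of 0) ^ 2)⁻¹,
   FreeGroup.of 1 * (FreeGroup.of 2) ^ 2 * (FreeGroup.of 2 * (FreeGroup.of 1) ^ 2)⁻¹}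

/-- The group G(3) = ⟨a, b, c | a^6 = b^6 = c^6 = 1, ab^2 = ba^2, ac^2 = ca^2, bc^2 = cb^2⟩. -/
abbrev G3 : Type := PresentedGroup G3rels

open scoped commutatorElement

/-- Two 6-periodic sequences in a group, each satisfying the Fibonacci recurrence
`x i = x (i + 1) * x (i + 2)`, which commute termwise. -/
structure IsFibPair {G : Type*} [Group G] (x y : ℤ → G) : Prop where
  fib_left : ∀ i, x i = x (i + 1) * x (i + 2)
  fib_right : ∀ i, y i = y (i + 1) * y (i + 2)
  periodic_left : ∀ i, x (i + 6) = x i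
  periodic_right : ∀ i, y (i + 6) = y i
  comm : ∀ i, Commute (x i) (y i)

section SemiconjBy

variable {G : Type*} [Group G] {g s w a b c d e : G}

theorem SemiconjBy.inv_left_of_inv (h : SemiconjBy g a a⁻¹) :
    SemiconjBy g⁻¹ a a⁻¹ := by
  simpa only [inv_inv] using h.inv_right.inv_symm_left

theorem SemiconjBy.conj_inv_of_commute (hg : Commute g c) (h : SemiconjBy c a b)
    (ha : SemiconjBy g a a⁻¹) : SemiconjBy g b b⁻¹ := by
  have := (h.inv_right.mul_left ha).mul_left h.inv_symm_left
  rwa [← hg.eq, mul_inv_cancel_right] at this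

theorem SemiconjBy.commute_sq_of_inv (h : SemiconjBy g a a⁻¹) : Commute (g ^ 2) a := by
  have := h.inv_right.mul_left h
  rwa [inv_inv, ← pow_two] at this

theorem SemiconjBy.commute_sq_of_mul (ha : SemiconjBy g a (a * c)) (hc : SemiconjBy g c c⁻¹) :
    Commute (g ^ 2) a := by
  have := (ha.mul_right hc).mul_left ha
  rwa [mul_inv_cancel_right, ← pow_two] at this

theorem SemiconjBy.inv_left_of_mul (ha : SemiconjBy g a (a * c)) (hc : SemiconjBy g c c⁻¹) :
    SemiconjBy g⁻¹ a (a * c) := by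
  have := (ha.mul_right hc).inv_symm_left
  rwa [mul_inv_cancel_right] at this

theorem SemiconjBy.inv_left_of_inv_mul (hd : SemiconjBy g d (d⁻¹ * c)) (hc : Commute g c) :
    SemiconjBy g⁻¹ d (c * d⁻¹) := by
  have := (SemiconjBy.mul_right hc hd.inv_right).inv_symm_left
  rwa [mul_inv_rev, inv_inv, mul_inv_cancel_left] at this

theorem SemiconjBy.sq_left_of_inv_mul (hd : SemiconjBy g d (d⁻¹ * c)) (hc : Commute g c) :
    SemiconjBy (g ^ 2) d (c⁻¹ * d * c) := by
  have := (hd.inv_right.mul_right hc).mul_left hd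
  rwa [mul_inv_rev, inv_inv, ← pow_two] at this

theorem SemiconjBy.commute_of_inv_mul (hs : SemiconjBy s d (d⁻¹ * c)) (hsc : Commute s c)
    (hwd : SemiconjBy w d (d⁻¹ * e)) (hwc : SemiconjBy w c c⁻¹)
    (hws : SemiconjBy w (s ^ 2) (s ^ 2 * c)) (hse : Commute (s ^ 2) e) (hce : Commute c e) :
    Commute d c := by
  have h1 := hs.sq_left_of_inv_mul hsc
  have h2 : SemiconjBy w (s ^ 2 * d) (s ^ 2 * c * (d⁻¹ * e)) := hws.mul_right hwd
  have h3 : SemiconjBy w (c⁻¹ * d * c * s ^ 2) (c⁻¹⁻¹ * (d⁻¹ * e) * c⁻¹ * (s ^ 2 * c)) :=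
    ((hwc.inv_right.mul_right hwd).mul_right hwc).mul_right hws
  rw [h1.eq] at h2
  have h4 := mul_right_cancel (h2.eq.symm.trans h3.eq)
  have h5 := h1.inv_right.eq
  have h6 := (hsc.pow_left 2).eq
  have h7 := hse.eq
  have h8 := hce.inv_left.eq
  have h9 : s ^ 2 * c * (d⁻¹ * e) = d⁻¹ * e * (s ^ 2 * c) := by
    calc s ^ 2 * c * (d⁻¹ * e) = c * (s ^ 2 * d⁻¹) * e := by rw [h6]; group
      _ = d⁻¹ * c * (s ^ 2 * e) := by rw [h5]; group
      _ = d⁻¹ * c * (e * s ^ 2) := by rw [h7]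
      _ = d⁻¹ * e * (s ^ 2 * c) := by rw [h6, mul_assoc d⁻¹, ← mul_assoc c, hce.eq]; group
  rw [h9] at h4
  have h10 : d⁻¹ * e = c * d⁻¹ * c⁻¹ * e := by
    calc d⁻¹ * e = c⁻¹⁻¹ * (d⁻¹ * e) * c⁻¹ := mul_right_cancel h4
      _ = c * d⁻¹ * (e * c⁻¹) := by group
      _ = c * d⁻¹ * c⁻¹ * e := by rw [← h8]; group
  have h11 : Commute c d⁻¹ := mul_inv_eq_iff_eq_mul.1 (mul_right_cancel h10).symm
  simpa using h11.inv_right.symm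

end SemiconjBy

section Subgroup

variable {G : Type*} [Group G]

theorem Subgroup.mem_normalizer_closure {S : Set G} {g : G} {n : ℕ}
    (hg : g ^ (n + 1) ∈ Subgroup.closure S)
    (hS : ∀ s ∈ S, ∃ s' ∈ Subgroup.closure S, SemiconjBy g s s') :
    g ∈ Subgroup.normalizer (Subgroup.closure S) := by
  have key : ∀ s ∈ Subgroup.closure S, g * s * g⁻¹ ∈ Subgroup.closure S := by
    intro s hs
    have : Subgroup.closure S ≤ (Subgroup.closure S).comap (MulAut.conj g).toMonoidHom := by
      rw [Subgroup.closure_le]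
      intro s hs
      obtain ⟨s', hs', h⟩ := hS s hs
      simpa [h.eq] using hs'
    simpa using this hs
  have key_pow : ∀ m : ℕ, ∀ s ∈ Subgroup.closure S, g ^ m * s * (g ^ m)⁻¹ ∈ Subgroup.closure S := by
    intro m
    induction m with
    | zero => simp
    | succ m ih =>
      intro s hs
      have := key _ (ih s hs)
      simpa only [pow_succ', mul_inv_rev, mul_assoc] using this
  refine Subgroup.mem_normalizer_iff.2 fun s => ⟨key s, fun hs => ?_⟩
  have := mul_mem (mul_mem (inv_mem hg) (key_pow n _ hs)) hg
  convert this using 1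
  rw [pow_succ]
  group

theorem Subgroup.commutator_closure_le {S : Set G} {N : Subgroup G}
    (hN : S ⊆ (Subgroup.normalizer (N : Set G) : Set G)) (hS : ∀ s ∈ S, ∀ t ∈ S, ⁅s, t⁆ ∈ N) :
    ⁅Subgroup.closure S, Subgroup.closure S⁆ ≤ N := by
  have hN' : Subgroup.closure S ≤ Subgroup.normalizer (N : Set G) := (Subgroup.closure_le _).2 hN
  have step : ∀ t, (∀ s ∈ S, ⁅s, t⁆ ∈ N) → ∀ s ∈ Subgroup.closure S, ⁅s, t⁆ ∈ N := by
    intro t ht s hs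
    induction hs using Subgroup.closure_induction with
    | mem s hs => exact ht s hs
    | one => simp
    | mul s s' hs hs' h h' =>
      have := mul_mem ((Subgroup.mem_normalizer_iff.1 (hN' hs) _).1 h') h
      convert this using 1
      simp only [commutatorElement_def]
      group
    | inv s hs h =>
      have := (Subgroup.mem_normalizer_iff.1 (inv_mem (hN' hs)) _).1 (inv_mem h)
      convert this using 1
      simp only [commutatorElement_def]
      group
  rw [Subgroup.commutator_le]
  intro s hs t ht
  refine step t (fun s hs => ?_) s hs
  rw [← inv_mem_iff, commutatorElement_inv]
  refine step s (fun t ht => hS t ht s hs) t ht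

end Subgroup

namespace IsFibPair

variable {G : Type*} [Group G] {x y : ℤ → G}

theorem symm (h : IsFibPair x y) : IsFibPair y x :=
  ⟨h.fib_right, h.fib_left, h.periodic_right, h.periodic_left, fun i => (h.comm i).symm⟩

theorem fib_add_one (h : IsFibPair x y) (i : ℤ) : x (i + 1) = x (i + 2) * x (i + 3) := by
  simpa only [add_assoc, Int.reduceAdd] using h.fib_left (i + 1)

theorem add_three (h : IsFibPair x y) (i : ℤ) : x (i + 3) = (x (i + 2))⁻¹ * x (i + 1) := by
  rw [h.fib_add_one i, inv_mul_cancel_left]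

theorem add_two (h : IsFibPair x y) (i : ℤ) : x (i + 2) = (x (i + 1))⁻¹ * x i := by
  rw [h.fib_left i, inv_mul_cancel_left]

theorem sub_one (h : IsFibPair x y) (i : ℤ) : x (i - 1) = x i * x (i + 1) := by
  have := h.fib_left (i - 1)
  rwa [show i - 1 + 1 = i by ring, show i - 1 + 2 = i + 1 by ring] at this

theorem eq_sq_mul_sq (h : IsFibPair x y) (i : ℤ) :
    x (i + 1) = x i ^ 2 * x (i + 1) * x i ^ 2 := by
  have h3 : x (i + 3) = x (i + 4) * x (i + 5) := by
    simpa only [add_assoc, Int.reduceAdd] using h.fib_left (i + 3)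
  have h4 : x (i + 4) = x (i + 5) * x i := by
    simpa only [add_assoc, Int.reduceAdd, h.periodic_left] using h.fib_left (i + 4)
  have h5 : x (i + 5) = x i * x (i + 1) := by
    have h7 := h.periodic_left (i + 1)
    have := h.fib_left (i + 5)
    simp only [add_assoc, Int.reduceAdd, h.periodic_left] at this h7
    rwa [h7] at this
  have key : (x (i + 2))⁻¹ * x (i + 1) = x i * x (i + 1) * x i * (x i * x (i + 1)) := by
    rw [← h.add_three, h3, h4, h5]
  rw [h.add_two] at key
  have := congrArg (fun g => x i * g * (x (i + 1))⁻¹) key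
  simpa only [mul_inv_rev, inv_inv, mul_assoc, mul_inv_cancel_left, mul_inv_cancel, mul_one,
    pow_two] using this

theorem semiconjBy_add_one_sq (h : IsFibPair x y) (i : ℤ) :
    SemiconjBy (x (i + 1)) (x i ^ 2) (x i ^ 2)⁻¹ := by
  have := h.eq_sq_mul_sq i
  rw [SemiconjBy, eq_inv_mul_iff_mul_eq, ← mul_assoc]
  exact this.symm

theorem semiconjBy_add_two_sq (h : IsFibPair x y) (i : ℤ) :
    SemiconjBy (x (i + 2)) (x i ^ 2) (x i ^ 2)⁻¹ := by
  rw [h.add_two]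
  exact (h.semiconjBy_add_one_sq i).inv_left_of_inv.mul_left (Commute.self_pow (x i) 2)

theorem semiconjBy_sub_one_sq (h : IsFibPair x y) (i : ℤ) :
    SemiconjBy (x (i - 1)) (x i ^ 2) (x i ^ 2)⁻¹ := by
  rw [h.sub_one]
  exact SemiconjBy.mul_left (Commute.self_pow (x i) 2).inv_right (h.semiconjBy_add_one_sq i)

theorem sub_two (h : IsFibPair x y) (i : ℤ) : x (i - 2) = x (i - 1) * x i := by
  have := h.sub_one (i - 1)
  rwa [sub_sub, sub_add_cancel, one_add_one_eq_two] at this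

theorem semiconjBy_sub_two_sq (h : IsFibPair x y) (i : ℤ) :
    SemiconjBy (x (i - 2)) (x i ^ 2) (x i ^ 2)⁻¹ := by
  rw [h.sub_two]
  exact (h.semiconjBy_sub_one_sq i).mul_left (Commute.self_pow (x i) 2)

theorem sq_add_three (h : IsFibPair x y) (i : ℤ) : x (i + 3) ^ 2 = (x i ^ 2)⁻¹ := by
  have key := congrArg (fun g => (x (i + 2))⁻¹ * x (i + 1) * g⁻¹ * x (i + 1))
    (h.eq_sq_mul_sq (i + 1))
  simp only [add_assoc, Int.reduceAdd] at key
  rw [h.add_three, h.fib_left i, pow_two, ← mul_assoc, key]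
  simp only [pow_two]
  group

/-- The commutator `(x i)⁻¹ (y (i + 1)) (x i) (y (i + 1))⁻¹`. -/
def twist (x y : ℤ → G) (i : ℤ) : G := (x i)⁻¹ * y (i + 1) * x i * (y (i + 1))⁻¹

/-- The commutator `(x i)⁻² (y (i + 1)) (x i)² (y (i + 1))⁻¹`. -/
def shear (x y : ℤ → G) (i : ℤ) : G := (x i ^ 2)⁻¹ * (y (i + 1) * x i ^ 2 * (y (i + 1))⁻¹)

theorem twist_symm (h : IsFibPair x y) (i : ℤ) : twist y x i = twist x y i := by
  have h0 := (h.comm (i - 1)).eq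
  rw [h.sub_one i, h.symm.sub_one i] at h0
  have h1 := (h.comm i).inv_left.symm.eq
  have h2 := (h.comm (i + 1)).inv_right.eq
  calc (y i)⁻¹ * x (i + 1) * y i * (x (i + 1))⁻¹
      = (y i)⁻¹ * (x i)⁻¹ * (x i * x (i + 1) * (y i * y (i + 1))) *
          (y (i + 1))⁻¹ * (x (i + 1))⁻¹ := by group
    _ = (y i)⁻¹ * ((x i)⁻¹ * y i) * y (i + 1) * x i * (x (i + 1) * (y (i + 1))⁻¹) *
          (x (i + 1))⁻¹ := by rw [h0]; group
    _ = (x i)⁻¹ * y (i + 1) * x i * (y (i + 1))⁻¹ := by rw [← h1, h2]; group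

theorem semiconjBy_twist (x y : ℤ → G) (i : ℤ) :
    SemiconjBy (x i) (twist x y i) (y (i + 1) * x i * (y (i + 1))⁻¹ * (x i)⁻¹) := by
  simp only [SemiconjBy, twist]
  group

theorem commute_twist (h : IsFibPair x y) (i : ℤ) : Commute ((y i)⁻¹ * x i) (twist x y i) := by
  have h0 := (h.comm (i + 2)).eq
  rw [h.add_two i, h.symm.add_two i] at h0
  have h1 := (h.comm i).inv_right.eq
  have h2 := (h.comm (i + 1)).inv_right.eq
  have key : y (i + 1) * x i * (y (i + 1))⁻¹ * (x i)⁻¹ =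
      x (i + 1) * y i * (x (i + 1))⁻¹ * (y i)⁻¹ := by
    calc y (i + 1) * x i * (y (i + 1))⁻¹ * (x i)⁻¹
        = y (i + 1) * x (i + 1) * ((x (i + 1))⁻¹ * x i * ((y (i + 1))⁻¹ * y i)) *
            (y i)⁻¹ * (x i)⁻¹ := by group
      _ = y (i + 1) * (x (i + 1) * (y (i + 1))⁻¹) * y i * (x (i + 1))⁻¹ * (x i * (y i)⁻¹) *
            (x i)⁻¹ := by rw [h0]; group
      _ = x (i + 1) * y i * (x (i + 1))⁻¹ * (y i)⁻¹ := by rw [h1, h2]; group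
  have hx := semiconjBy_twist x y i
  have hy := semiconjBy_twist y x i
  rw [h.twist_symm, ← key] at hy
  exact hy.inv_symm_left.mul_left hx

theorem shear_eq (x y : ℤ → G) (i : ℤ) :
    shear x y i = (x i)⁻¹ * twist x y i * x i * twist x y i := by
  simp only [shear, twist, pow_two]
  group

theorem shear_symm (h : IsFibPair x y) (i : ℤ) : shear y x i = shear x y i := by
  rw [shear_eq, shear_eq, h.twist_symm]
  have h1 := (h.comm i).inv_right.eq
  have h2 := (h.commute_twist i).eq
  have h3 : (y i)⁻¹ * twist x y i * y i = (x i)⁻¹ * twist x y i * x i := by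
    calc (y i)⁻¹ * twist x y i * y i
        = (x i)⁻¹ * (x i * (y i)⁻¹ * twist x y i) * y i := by group
      _ = (x i)⁻¹ * twist x y i * x i := by rw [h1, h2, ← h1]; group
  rw [h3]

theorem commute_sq (h : IsFibPair x y) (i : ℤ) : Commute (y i) (x i ^ 2) :=
  (h.comm i).symm.pow_right 2

theorem commute_add_three_sq (h : IsFibPair x y) (i : ℤ) : Commute (y (i + 3)) (x i ^ 2) := by
  have := h.commute_sq (i + 3)
  rw [h.sq_add_three] at this
  simpa only [inv_inv] using this.inv_right

theorem sq_mul_shear (x y : ℤ → G) (i : ℤ) :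
    x i ^ 2 * shear x y i = y (i + 1) * x i ^ 2 * (y (i + 1))⁻¹ := by
  rw [shear, mul_inv_cancel_left]

theorem semiconjBy_add_one_sq' (x y : ℤ → G) (i : ℤ) :
    SemiconjBy (y (i + 1)) (x i ^ 2) (x i ^ 2 * shear x y i) := by
  rw [sq_mul_shear]
  exact SemiconjBy.conj_mk _ _

theorem semiconjBy_add_two_sq' (h : IsFibPair x y) (i : ℤ) :
    SemiconjBy (y (i + 2)) (x i ^ 2) (x i ^ 2 * shear x y i) := by
  have := h.commute_add_three_sq i
  have := (semiconjBy_add_one_sq' x y i).mul_left (SemiconjBy.inv_symm_left this)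
  rwa [h.symm.add_three, mul_inv_rev, inv_inv, mul_inv_cancel_left] at this

theorem semiconjBy_add_one_sq_mul_shear (h : IsFibPair x y) (i : ℤ) :
    SemiconjBy (x (i + 1)) (x i ^ 2 * shear x y i) (x i ^ 2 * shear x y i)⁻¹ :=
  .conj_inv_of_commute (h.comm _) (semiconjBy_add_one_sq' x y i) (h.semiconjBy_add_one_sq i)

theorem semiconjBy_add_two_sq_mul_shear (h : IsFibPair x y) (i : ℤ) :
    SemiconjBy (x (i + 2)) (x i ^ 2 * shear x y i) (x i ^ 2 * shear x y i)⁻¹ :=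
  .conj_inv_of_commute (h.comm _) (h.semiconjBy_add_two_sq' i) (h.semiconjBy_add_two_sq i)

theorem commute_shear (h : IsFibPair x y) (i : ℤ) : Commute (x i) (shear x y i) := by
  have h1 := (h.semiconjBy_add_one_sq_mul_shear i).inv_right.mul_left
    (h.semiconjBy_add_two_sq_mul_shear i)
  rw [← h.fib_left, inv_inv] at h1
  have h2 := SemiconjBy.mul_right (Commute.self_pow (x i) 2).inv_right h1
  rwa [inv_mul_cancel_left] at h2

theorem semiconjBy_add_one_shear (h : IsFibPair x y) (i : ℤ) :
    SemiconjBy (x (i + 1)) (shear x y i) (shear x y i)⁻¹ := by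
  have h1 := (h.semiconjBy_add_one_sq i).inv_right.mul_right (h.semiconjBy_add_one_sq_mul_shear i)
  rw [inv_mul_cancel_left, ((h.commute_shear i).pow_left 2).eq] at h1
  simpa using h1

theorem semiconjBy_add_two_shear (h : IsFibPair x y) (i : ℤ) :
    SemiconjBy (x (i + 2)) (shear x y i) (shear x y i)⁻¹ := by
  rw [h.add_two]
  exact (h.semiconjBy_add_one_shear i).inv_left_of_inv.mul_left (h.commute_shear i)

theorem semiconjBy_sub_one_shear (h : IsFibPair x y) (i : ℤ) :
    SemiconjBy (x (i - 1)) (shear x y i) (shear x y i)⁻¹ := by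
  rw [h.sub_one]
  exact SemiconjBy.mul_left (h.commute_shear i).inv_right (h.semiconjBy_add_one_shear i)

theorem semiconjBy_sub_two_shear (h : IsFibPair x y) (i : ℤ) :
    SemiconjBy (x (i - 2)) (shear x y i) (shear x y i)⁻¹ := by
  rw [h.sub_two]
  exact (h.semiconjBy_sub_one_shear i).mul_left (h.commute_shear i)

theorem semiconjBy_sub_one_sq' (h : IsFibPair x y) (i : ℤ) :
    SemiconjBy (y (i - 1)) (x i ^ 2) (x i ^ 2 * shear x y i) := by
  have h1 := h.symm.commute_shear i
  rw [h.shear_symm] at h1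
  rw [h.symm.sub_one]
  exact ((h.commute_sq i).mul_right h1).semiconjBy.mul_left (semiconjBy_add_one_sq' x y i)

theorem commute_sq_shear (h : IsFibPair x y) (i : ℤ) : Commute (x i ^ 2) (shear x y i) :=
  (h.commute_shear i).pow_left 2

theorem commute_shear_right (h : IsFibPair x y) (i : ℤ) : Commute (y i) (shear x y i) := by
  rw [← h.shear_symm]
  exact h.symm.commute_shear i

theorem semiconjBy_add_one_shear_right (h : IsFibPair x y) (i : ℤ) :
    SemiconjBy (y (i + 1)) (shear x y i) (shear x y i)⁻¹ := by
  rw [← h.shear_symm]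
  exact h.symm.semiconjBy_add_one_shear i

theorem semiconjBy_sub_one_shear_right (h : IsFibPair x y) (i : ℤ) :
    SemiconjBy (y (i - 1)) (shear x y i) (shear x y i)⁻¹ := by
  rw [← h.shear_symm]
  exact h.symm.semiconjBy_sub_one_shear i

theorem commute_shear_add_one (h : IsFibPair x y) (i : ℤ) :
    Commute (shear x y i) (shear x y (i + 1)) := by
  have h1 := (h.semiconjBy_sub_one_shear (i + 1)).commute_sq_of_inv
  rw [add_sub_cancel_right] at h1
  have h2 := h.commute_shear_right (i + 1)
  rw [shear]
  exact h1.inv_left.mul_left ((h2.mul_left h1).mul_left h2.inv_left)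

theorem semiconjBy_twist' (h : IsFibPair x y) (i : ℤ) :
    SemiconjBy (x i) (twist x y i) ((twist x y i)⁻¹ * shear x y i) := by
  rw [SemiconjBy, mul_assoc, ← (h.commute_shear i).eq, shear_eq]
  group

theorem semiconjBy_add_one_twist (h : IsFibPair x y) (i : ℤ) :
    SemiconjBy (x (i + 1)) (twist x y i) ((twist x y i)⁻¹ * shear x y (i + 1)) := by
  have h1 := (h.semiconjBy_sub_one_sq' (i + 1)).inv_left_of_mul
    (h.semiconjBy_sub_one_shear_right (i + 1))
  rw [add_sub_cancel_right, (h.commute_sq_shear (i + 1)).eq] at h1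
  have h2 : shear x y (i + 1) = (y i)⁻¹ * x (i + 1) ^ 2 * y i * (x (i + 1) ^ 2)⁻¹ := by
    rw [h1.eq]; group
  rw [h2, ← h.twist_symm]
  simp only [SemiconjBy, twist, pow_two]
  group

theorem commute_twist_shear (h : IsFibPair x y) (i : ℤ) :
    Commute (twist x y i) (shear x y i) := by
  have h1 := h.symm.semiconjBy_add_one_twist i
  rw [h.twist_symm, h.shear_symm] at h1
  have h2 := (h.semiconjBy_sub_one_shear (i + 1)).commute_sq_of_inv
  rw [add_sub_cancel_right] at h2
  exact (h.semiconjBy_twist' i).commute_of_inv_mul (h.commute_shear i) h1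
    (h.semiconjBy_add_one_shear_right i) (semiconjBy_add_one_sq' x y i) h2
    (h.commute_shear_add_one i)

theorem commute_twist_shear_add_one (h : IsFibPair x y) (i : ℤ) :
    Commute (twist x y i) (shear x y (i + 1)) := by
  have h1 := h.symm.semiconjBy_twist' i
  rw [h.twist_symm, h.shear_symm] at h1
  have h2 := (h.semiconjBy_add_one_shear i).commute_sq_of_inv
  have h3 := h.semiconjBy_sub_one_shear_right (i + 1)
  have h4 := h.semiconjBy_sub_one_sq' (i + 1)
  rw [add_sub_cancel_right] at h3 h4
  exact (h.semiconjBy_add_one_twist i).commute_of_inv_mul (h.commute_shear (i + 1)) h1 h3 h4 h2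
    (h.commute_shear_add_one i).symm

theorem commute_sq_twist (h : IsFibPair x y) (i : ℤ) : Commute (x i ^ 2) (twist x y i) := by
  have := (h.semiconjBy_twist' i).sq_left_of_inv_mul (h.commute_shear i)
  rwa [mul_assoc, (h.commute_twist_shear i).eq, inv_mul_cancel_left] at this

theorem commute_add_one_sq_twist (h : IsFibPair x y) (i : ℤ) :
    Commute (x (i + 1) ^ 2) (twist x y i) := by
  have := (h.semiconjBy_add_one_twist i).sq_left_of_inv_mul (h.commute_shear (i + 1))
  rwa [mul_assoc, (h.commute_twist_shear_add_one i).eq, inv_mul_cancel_left] at this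

theorem semiconjBy_sub_one_twist (h : IsFibPair x y) (i : ℤ) :
    SemiconjBy (x (i - 1)) (twist x y i)
      ((shear x y i)⁻¹ * twist x y i * (shear x y (i + 1))⁻¹) := by
  have h1 := h.semiconjBy_sub_one_shear (i + 1)
  rw [add_sub_cancel_right] at h1
  have := ((h.semiconjBy_twist' i).inv_right.mul_right h1).mul_left (h.semiconjBy_add_one_twist i)
  rwa [← h.sub_one, mul_inv_rev, inv_inv] at this

theorem commute_sub_one_sq_twist (h : IsFibPair x y) (i : ℤ) :
    Commute (x (i - 1) ^ 2) (twist x y i) := by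
  have h1 := h.semiconjBy_sub_one_twist i
  have h2 := h.semiconjBy_sub_two_shear (i + 1)
  rw [show i + 1 - 2 = i - 1 by ring] at h2
  have := (((h.semiconjBy_sub_one_shear i).inv_right.mul_right h1).mul_right
    h2.inv_right).mul_left h1
  rwa [inv_inv, inv_inv, ← pow_two, mul_assoc, mul_assoc, inv_mul_cancel, mul_one,
    mul_inv_cancel_left] at this

theorem twist_sub_one (h : IsFibPair x y) (i : ℤ) :
    twist x y (i - 1) = shear x y i * shear x y (i + 1) * (twist x y i)⁻¹ := by
  have h1 : twist x y (i - 1) =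
      (x (i + 1))⁻¹ * (y i * (twist y x i)⁻¹ * (y i)⁻¹) * x (i + 1) := by
    have := (h.comm i).eq
    rw [twist, twist, h.sub_one, sub_add_cancel, ← mul_assoc _ (x i), mul_assoc _ _ (x i), ← this]
    group
  have h2 := (h.symm.semiconjBy_twist' i).inv_right
  have h3 := (h.semiconjBy_add_one_twist i).inv_left_of_inv_mul (h.commute_shear (i + 1))
  have h4 := (h.semiconjBy_add_one_shear i).inv_left_of_inv.inv_right.mul_right h3
  rw [h1, h2.eq, mul_inv_cancel_right, h.twist_symm, h.shear_symm, mul_inv_rev, inv_inv, h4.eq]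
  group

theorem shear_sub_one (h : IsFibPair x y) (i : ℤ) :
    shear x y (i - 1) = shear x y i * shear x y (i + 1) * (twist x y i)⁻¹ ^ 2 := by
  have h1 := (h.semiconjBy_sub_one_twist i).inv_right
  have h2 := (h.commute_twist_shear i).inv_left.eq
  have h3 := (h.commute_twist_shear_add_one i).inv_left.eq
  have h4 : ((shear x y i)⁻¹ * twist x y i * (shear x y (i + 1))⁻¹)⁻¹ = twist x y (i - 1) := by
    rw [h.twist_sub_one, mul_inv_rev, mul_inv_rev, inv_inv, inv_inv, h2, ← mul_assoc,
      ← (h.commute_shear_add_one i).eq, mul_assoc, ← h3]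
  rw [h4] at h1
  rw [shear_eq, mul_assoc _ _ (x (i - 1)), ← h1.eq, inv_mul_cancel_left, h.twist_sub_one,
    ← mul_assoc, ← mul_assoc, h2, mul_assoc _ _ (shear x y (i + 1)), h3, pow_two]
  group

theorem commute_sq_sq_add_one (h : IsFibPair x y) (i : ℤ) : Commute (x i ^ 2) (x (i + 1) ^ 2) := by
  have := (h.semiconjBy_sub_one_sq (i + 1)).commute_sq_of_inv
  rwa [add_sub_cancel_right] at this

theorem commute_sq_sq_add_two (h : IsFibPair x y) (i : ℤ) : Commute (x i ^ 2) (x (i + 2) ^ 2) := by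
  have := (h.semiconjBy_sub_two_sq (i + 2)).commute_sq_of_inv
  rwa [add_sub_cancel_right] at this

theorem commute_sq_right (h : IsFibPair x y) (i : ℤ) : Commute (x i ^ 2) (y i ^ 2) :=
  (h.comm i).pow_pow 2 2

theorem commute_sq_right_add_one (h : IsFibPair x y) (i : ℤ) :
    Commute (x i ^ 2) (y (i + 1) ^ 2) :=
  ((semiconjBy_add_one_sq' x y i).commute_sq_of_mul (h.semiconjBy_add_one_shear_right i)).symm

theorem commute_sq_right_add_two (h : IsFibPair x y) (i : ℤ) :
    Commute (x i ^ 2) (y (i + 2) ^ 2) := by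
  have h1 := h.symm.semiconjBy_add_two_shear i
  rw [h.shear_symm] at h1
  exact ((h.semiconjBy_add_two_sq' i).commute_sq_of_mul h1).symm

/-- Generators of a lattice of rank at most nine, normalised by the terms of `x` and `y`. -/
def latticeGen (x y : ℤ → G) : Fin 9 → G :=
  ![x (-1) ^ 2, x 0 ^ 2, x 1 ^ 2, y (-1) ^ 2, y 0 ^ 2, y 1 ^ 2,
    twist x y 0, shear x y 0, shear x y 1]

/-- The subgroup generated by `latticeGen x y`. -/
def lattice (x y : ℤ → G) : Subgroup G := Subgroup.closure (Set.range (latticeGen x y))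

theorem latticeGen_mem (x y : ℤ → G) (j : Fin 9) : latticeGen x y j ∈ lattice x y :=
  Subgroup.subset_closure ⟨j, rfl⟩

theorem forall_latticeGen {x y : ℤ → G} {p : G → Prop} :
    (∀ j, p (latticeGen x y j)) ↔ (p (x (-1) ^ 2) ∧ p (x 0 ^ 2) ∧ p (x 1 ^ 2)) ∧
      (p (y (-1) ^ 2) ∧ p (y 0 ^ 2) ∧ p (y 1 ^ 2)) ∧
      p (twist x y 0) ∧ p (shear x y 0) ∧ p (shear x y 1) := by
  simp [latticeGen, Fin.forall_fin_succ, and_assoc]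

theorem forall_latticeGen_swap (h : IsFibPair x y) {p : G → Prop} :
    (∀ j, p (latticeGen y x j)) ↔ ∀ j, p (latticeGen x y j) := by
  simp only [forall_latticeGen, h.twist_symm, h.shear_symm]
  tauto

theorem lattice_symm (h : IsFibPair x y) : lattice y x = lattice x y := by
  refine le_antisymm ?_ ?_
  · rw [lattice, Subgroup.closure_le, Set.range_subset_iff, h.forall_latticeGen_swap]
    exact latticeGen_mem x y
  · rw [lattice, Subgroup.closure_le, Set.range_subset_iff, ← h.forall_latticeGen_swap]
    exact latticeGen_mem y x

theorem commute_sq_latticeGen (h : IsFibPair x y) (j : Fin 9) :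
    Commute (x (-1) ^ 2) (latticeGen x y j) ∧ Commute (x 0 ^ 2) (latticeGen x y j) ∧
      Commute (x 1 ^ 2) (latticeGen x y j) := by
  revert j
  have A1 := h.commute_sq_sq_add_one
  have A2 := h.commute_sq_sq_add_two
  have B0 := h.commute_sq_right
  have B1 := h.commute_sq_right_add_one
  have B2 := h.commute_sq_right_add_two
  have B1' := fun i => (h.symm.commute_sq_right_add_one i).symm
  have B2' := fun i => (h.symm.commute_sq_right_add_two i).symm
  have A1n := A1 (-1)
  have A2n := A2 (-1)
  have B1n := B1 (-1)
  have B2n := B2 (-1)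
  have B1n' := B1' (-1)
  have B2n' := B2' (-1)
  rw [neg_add_cancel] at A1n B1n B1n'
  rw [neg_add_eq_sub, show (2 : ℤ) - 1 = 1 by norm_num] at A2n B2n B2n'
  refine (forall_latticeGen (p := fun g => Commute (x (-1) ^ 2) g ∧ Commute (x 0 ^ 2) g ∧
    Commute (x 1 ^ 2) g)).2 ?_
  refine ⟨⟨⟨.refl _, A1n.symm, A2n.symm⟩, ⟨A1n, .refl _, (A1 0).symm⟩,
    ⟨A2n, A1 0, .refl _⟩⟩, ⟨⟨B0 (-1), B1n', B2n'⟩, ⟨B1n, B0 0, B1' 0⟩,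
    ⟨B2n, B1 0, B0 1⟩⟩, ⟨h.commute_sub_one_sq_twist 0, h.commute_sq_twist 0,
    h.commute_add_one_sq_twist 0⟩, ⟨(h.semiconjBy_sub_one_shear 0).commute_sq_of_inv,
    h.commute_sq_shear 0, (h.semiconjBy_add_one_shear 0).commute_sq_of_inv⟩,
    (h.semiconjBy_sub_two_shear 1).commute_sq_of_inv,
    (h.semiconjBy_sub_one_shear 1).commute_sq_of_inv, h.commute_sq_shear 1⟩

theorem latticeGen_commute (h : IsFibPair x y) (j k : Fin 9) :
    Commute (latticeGen x y j) (latticeGen x y k) := by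
  have hx := h.commute_sq_latticeGen
  have hy : ∀ k, Commute (y (-1) ^ 2) (latticeGen x y k) ∧ Commute (y 0 ^ 2) (latticeGen x y k) ∧
      Commute (y 1 ^ 2) (latticeGen x y k) :=
    (h.forall_latticeGen_swap (p := fun g => Commute (y (-1) ^ 2) g ∧ Commute (y 0 ^ 2) g ∧
      Commute (y 1 ^ 2) g)).1 h.symm.commute_sq_latticeGen
  have d0 := h.commute_twist_shear 0
  have d1 := h.commute_twist_shear_add_one 0
  have c1 := h.commute_shear_add_one 0
  rw [zero_add] at d1 c1
  have hx' := fun k => And.intro (hx k).1.symm (And.intro (hx k).2.1.symm (hx k).2.2.symm)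
  have hy' := fun k => And.intro (hy k).1.symm (And.intro (hy k).2.1.symm (hy k).2.2.symm)
  revert j
  rw [forall_latticeGen (p := fun g => Commute g (latticeGen x y k))]
  refine ⟨hx k, hy k, ?_⟩
  revert k
  rw [forall_latticeGen (p := fun g => Commute (twist x y 0) g ∧ Commute (shear x y 0) g ∧
    Commute (shear x y 1) g)]
  exact ⟨⟨⟨(hx' 6).1, (hx' 7).1, (hx' 8).1⟩, ⟨(hx' 6).2.1, (hx' 7).2.1, (hx' 8).2.1⟩,
      (hx' 6).2.2, (hx' 7).2.2, (hx' 8).2.2⟩,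
    ⟨⟨(hy' 6).1, (hy' 7).1, (hy' 8).1⟩, ⟨(hy' 6).2.1, (hy' 7).2.1, (hy' 8).2.1⟩,
      (hy' 6).2.2, (hy' 7).2.2, (hy' 8).2.2⟩,
    ⟨.refl _, d0.symm, d1.symm⟩, ⟨d0, .refl _, c1.symm⟩, d1, c1, .refl _⟩

theorem lattice_isMulCommutative (h : IsFibPair x y) : IsMulCommutative (lattice x y) := by
  refine Subgroup.isMulCommutative_closure ?_
  rintro _ ⟨j, rfl⟩ _ ⟨k, rfl⟩
  exact h.latticeGen_commute j k

theorem shear_neg_one_mem_lattice (h : IsFibPair x y) : shear x y (-1) ∈ lattice x y := by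
  have := h.shear_sub_one 0
  rw [zero_sub, zero_add] at this
  rw [this]
  exact mul_mem (mul_mem (latticeGen_mem x y 7) (latticeGen_mem x y 8))
    (pow_mem (inv_mem (latticeGen_mem x y 6)) 2)

theorem mem_normalizer_lattice (h : IsFibPair x y) :
    x 0 ∈ Subgroup.normalizer (lattice x y) ∧ x 1 ∈ Subgroup.normalizer (lattice x y) := by
  have g := latticeGen_mem x y
  have g0 := h.semiconjBy_add_one_sq (-1)
  have g1 := h.semiconjBy_add_two_sq (-1)
  rw [neg_add_cancel] at g0
  rw [neg_add_eq_sub, show (2 : ℤ) - 1 = 1 by norm_num] at g1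
  constructor
  · refine Subgroup.mem_normalizer_closure (n := 1) (g 1) ?_
    refine Set.forall_mem_range.2
      ((forall_latticeGen (p := fun s => ∃ s' ∈ lattice x y, SemiconjBy (x 0) s s')).2 ?_)
    have h1 := h.symm.semiconjBy_sub_one_sq' 1
    rw [h.shear_symm] at h1
    have h2 := semiconjBy_add_one_sq' y x (-1)
    rw [h.shear_symm, neg_add_cancel] at h2
    exact ⟨⟨⟨_, inv_mem (g 0), g0⟩, ⟨_, g 1, Commute.self_pow _ _⟩,
      ⟨_, inv_mem (g 2), h.semiconjBy_sub_one_sq 1⟩⟩,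
      ⟨⟨_, mul_mem (g 3) h.shear_neg_one_mem_lattice, h2⟩, ⟨_, g 4, h.symm.commute_sq 0⟩,
      ⟨_, mul_mem (g 5) (g 8), h1⟩⟩,
      ⟨_, mul_mem (inv_mem (g 6)) (g 7), h.semiconjBy_twist' 0⟩, ⟨_, g 7, h.commute_shear 0⟩,
      ⟨_, inv_mem (g 8), h.semiconjBy_sub_one_shear 1⟩⟩
  · refine Subgroup.mem_normalizer_closure (n := 1) (g 2) ?_
    refine Set.forall_mem_range.2
      ((forall_latticeGen (p := fun s => ∃ s' ∈ lattice x y, SemiconjBy (x 1) s s')).2 ?_)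
    have h1 := h.symm.semiconjBy_add_two_sq' (-1)
    rw [h.shear_symm, neg_add_eq_sub, show (2 : ℤ) - 1 = 1 by norm_num] at h1
    have h2 := semiconjBy_add_one_sq' y x 0
    rw [h.shear_symm] at h2
    exact ⟨⟨⟨_, inv_mem (g 0), g1⟩,
      ⟨_, inv_mem (g 1), h.semiconjBy_add_one_sq 0⟩, ⟨_, g 2, Commute.self_pow _ _⟩⟩,
      ⟨⟨_, mul_mem (g 3) h.shear_neg_one_mem_lattice, h1⟩, ⟨_, mul_mem (g 4) (g 7), h2⟩,
      ⟨_, g 5, h.symm.commute_sq 1⟩⟩,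
      ⟨_, mul_mem (inv_mem (g 6)) (g 8), h.semiconjBy_add_one_twist 0⟩,
      ⟨_, inv_mem (g 7), h.semiconjBy_add_one_shear 0⟩, ⟨_, g 8, h.commute_shear 1⟩⟩

theorem commutator_le_lattice (h : IsFibPair x y) :
    ⁅Subgroup.closure {x 0, x 1, y 0, y 1}, Subgroup.closure {x 0, x 1, y 0, y 1}⁆ ≤
      lattice x y := by
  obtain ⟨hx0, hx1⟩ := h.mem_normalizer_lattice
  obtain ⟨hy0, hy1⟩ := h.symm.mem_normalizer_lattice
  rw [h.lattice_symm] at hy0 hy1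
  have key : ∀ {x y : ℤ → G}, IsFibPair x y → x 0 ∈ Subgroup.normalizer (lattice x y) →
      x 1 ∈ Subgroup.normalizer (lattice x y) →
      ⁅x 0, x 1⁆ ∈ lattice x y ∧ ⁅y 1, x 0⁆ ∈ lattice x y := by
    intro x y h hx0 hx1
    have g := latticeGen_mem x y
    constructor
    · have := mul_mem (mul_mem (g 0) ((Subgroup.mem_normalizer_iff''.1 hx1 _).1 (inv_mem (g 1))))
        (inv_mem (g 2))
      convert this using 1
      have h1 := h.sub_one 0
      simp only [zero_sub, zero_add] at h1
      simp only [latticeGen, Matrix.cons_val, commutatorElement_def, h1, pow_two]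
      group
    · have := (Subgroup.mem_normalizer_iff.1 hx0 _).1 (g 6)
      convert this using 1
      simp only [latticeGen, Matrix.cons_val, commutatorElement_def, twist, zero_add]
      group
  obtain ⟨h1, h2⟩ := key h hx0 hx1
  obtain ⟨h3, h4⟩ := key h.symm (h.lattice_symm ▸ hy0) (h.lattice_symm ▸ hy1)
  rw [h.lattice_symm] at h3 h4
  have h5 : ⁅x 0, y 0⁆ = 1 := commutatorElement_eq_one_iff_commute.2 (h.comm 0)
  have h6 : ⁅x 1, y 1⁆ = 1 := commutatorElement_eq_one_iff_commute.2 (h.comm 1)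
  have sw : ∀ {s t : G}, ⁅s, t⁆ ∈ lattice x y → ⁅t, s⁆ ∈ lattice x y := by
    intro s t hst
    rw [← commutatorElement_inv]
    exact inv_mem hst
  have h5 : ⁅x 0, y 0⁆ ∈ lattice x y := h5 ▸ one_mem _
  have h6 : ⁅x 1, y 1⁆ ∈ lattice x y := h6 ▸ one_mem _
  refine Subgroup.commutator_closure_le ?_ ?_
  · rintro _ (rfl | rfl | rfl | rfl) <;> assumption
  · rintro _ (rfl | rfl | rfl | rfl) _ (rfl | rfl | rfl | rfl) <;>
      first | simp | assumption | (apply sw; assumption)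

theorem sq_mem_commutator (h : IsFibPair x y) {n : G} (hn : n ∈ lattice x y) :
    n ^ 2 ∈ ⁅Subgroup.closure {x 0, x 1, y 0, y 1}, Subgroup.closure {x 0, x 1, y 0, y 1}⁆ := by
  have : IsMulCommutative (Subgroup.closure (Set.range (latticeGen x y))) :=
    h.lattice_isMulCommutative
  set H := Subgroup.closure {x 0, x 1, y 0, y 1} with hH
  have hx0 : x 0 ∈ H := Subgroup.subset_closure (by simp)
  have hx1 : x 1 ∈ H := Subgroup.subset_closure (by simp)
  have hy0 : y 0 ∈ H := Subgroup.subset_closure (by simp)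
  have hy1 : y 1 ∈ H := Subgroup.subset_closure (by simp)
  have sub : ∀ {x y : ℤ → G}, IsFibPair x y → x 0 ∈ H → x 1 ∈ H → x (-1) ∈ H := by
    intro x y h h0 h1
    simpa using h.sub_one 0 ▸ mul_mem h0 h1
  have inv : ∀ {g a : G}, g ∈ H → a ∈ H → SemiconjBy g a a⁻¹ → a ^ 2 ∈ ⁅H, H⁆ := by
    intro g a hg ha hga
    have := inv_mem (Subgroup.commutator_mem_commutator hg ha)
    rw [commutatorElement_def, hga.eq] at this
    simpa [pow_two] using this
  have sq : ∀ {x y : ℤ → G}, IsFibPair x y → x 0 ∈ H → x 1 ∈ H →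
      (x (-1) ^ 2) ^ 2 ∈ ⁅H, H⁆ ∧ (x 0 ^ 2) ^ 2 ∈ ⁅H, H⁆ ∧ (x 1 ^ 2) ^ 2 ∈ ⁅H, H⁆ := by
    intro x y h h0 h1
    have g0 := h.semiconjBy_add_one_sq (-1)
    rw [neg_add_cancel] at g0
    exact ⟨inv h0 (pow_mem (sub h h0 h1) 2) g0,
      inv h1 (pow_mem h0 2) (h.semiconjBy_add_one_sq 0),
      inv h0 (pow_mem h1 2) (h.semiconjBy_sub_one_sq 1)⟩
  have hd : twist x y 0 ∈ ⁅H, H⁆ := by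
    simpa [commutatorElement_def, twist] using
      Subgroup.commutator_mem_commutator (inv_mem hx0) hy1
  have hc : ∀ i, x i ∈ H → twist x y i ∈ H → shear x y i ∈ H := by
    intro i hx ht
    rw [shear_eq]
    exact mul_mem (mul_mem (mul_mem (inv_mem hx) ht) hx) ht
  induction hn using Subgroup.closure_induction with
  | mem s hs =>
    revert s
    refine Set.forall_mem_range.2 ((forall_latticeGen (p := fun g => g ^ 2 ∈ ⁅H, H⁆)).2 ?_)
    refine ⟨sq h hx0 hx1, sq h.symm hy0 hy1, pow_mem hd 2, ?_, ?_⟩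
    · refine inv hx1 ?_ (h.semiconjBy_add_one_shear 0)
      simp only [shear, zero_add]
      exact mul_mem (inv_mem (pow_mem hx0 2)) (mul_mem (mul_mem hy1 (pow_mem hx0 2)) (inv_mem hy1))
    · refine inv hx0 ?_ (h.semiconjBy_sub_one_shear 1)
      have hy2 : y (1 + 1) ∈ H := by
        rw [one_add_one_eq_two]
        simpa using h.symm.add_two 0 ▸ mul_mem (inv_mem hy1) hy0
      exact mul_mem (inv_mem (pow_mem hx1 2)) (mul_mem (mul_mem hy2 (pow_mem hx1 2)) (inv_mem hy2))
  | one => simp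
  | mul s t hs ht h1 h2 =>
    have : Commute s t := setLike_mul_comm hs ht
    rw [this.mul_pow]
    exact mul_mem h1 h2
  | inv s hs h1 => simpa using inv_mem h1

end IsFibPair

section ConjSeq

variable {G : Type*} [Group G] {a b c : G}

/-- The conjugates of `a⁻¹ * b` by the powers of `a`. -/
def conjSeq (a b : G) (i : ℤ) : G := a ^ (i - 1) * b * (a ^ i)⁻¹

theorem conjSeq_zero (a b : G) : conjSeq a b 0 = a⁻¹ * b := by simp [conjSeq]

theorem conjSeq_one (a b : G) : conjSeq a b 1 = b * a⁻¹ := by simp [conjSeq]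

theorem conjSeq_two (a b : G) : conjSeq a b 2 = a * b * (a ^ 2)⁻¹ := by
  simp [conjSeq, show (2 : ℤ) - 1 = 1 by norm_num, zpow_ofNat]

theorem conjSeq_self (a : G) (i : ℤ) : conjSeq a a i = 1 := by
  simp [conjSeq, zpow_sub_one]

theorem map_conjSeq {G' : Type*} [Group G'] (f : G →* G') (a b : G) (i : ℤ) :
    f (conjSeq a b i) = conjSeq (f a) (f b) i := by
  simp [conjSeq]

theorem semiconjBy_conjSeq (a b : G) (i : ℤ) :
    SemiconjBy a (conjSeq a b i) (conjSeq a b (i + 1)) := by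
  simp only [SemiconjBy, conjSeq]
  group

theorem conjSeq_fib (hab : a * b ^ 2 = b * a ^ 2) (i : ℤ) :
    conjSeq a b i = conjSeq a b (i + 1) * conjSeq a b (i + 2) := by
  calc conjSeq a b i = a ^ (i - 1) * (b * a ^ 2) * (a ^ (i + 2))⁻¹ := by
        simp only [conjSeq]
        group
    _ = _ := by
        rw [← hab]
        simp only [conjSeq, pow_two]
        group

theorem conjSeq_add_six (ha : a ^ 6 = 1) (i : ℤ) : conjSeq a b (i + 6) = conjSeq a b i := by
  have h : a ^ (6 : ℤ) = 1 := by exact_mod_cast ha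
  simp only [conjSeq, add_sub_right_comm, zpow_add _ _ (6 : ℤ), h, mul_one]

theorem commute_conjSeq (hab : a * b ^ 2 = b * a ^ 2) (hac : a * c ^ 2 = c * a ^ 2)
    (hbc : b * c ^ 2 = c * b ^ 2) (i : ℤ) : Commute (conjSeq a b i) (conjSeq a c i) := by
  have h : b * a⁻¹ * c = c * a⁻¹ * b := by
    refine mul_right_cancel (b := a ^ 2) ?_
    calc b * a⁻¹ * c * a ^ 2 = b * a⁻¹ * (c * a ^ 2) := by group
      _ = b * c ^ 2 := by rw [← hac]; group
      _ = c * a⁻¹ * (a * b ^ 2) := by rw [hbc]; group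
      _ = c * a⁻¹ * b * a ^ 2 := by rw [hab]; group
  calc conjSeq a b i * conjSeq a c i = a ^ (i - 1) * (b * a⁻¹ * c) * (a ^ i)⁻¹ := by
        simp only [conjSeq]
        group
    _ = _ := by
        rw [h]
        simp only [conjSeq]
        group

theorem isFibPair_conjSeq (ha : a ^ 6 = 1) (hab : a * b ^ 2 = b * a ^ 2)
    (hac : a * c ^ 2 = c * a ^ 2) (hbc : b * c ^ 2 = c * b ^ 2) :
    IsFibPair (conjSeq a b) (conjSeq a c) where
  fib_left := conjSeq_fib hab
  fib_right := conjSeq_fib hac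
  periodic_left := conjSeq_add_six ha
  periodic_right := conjSeq_add_six ha
  comm := commute_conjSeq hab hac hbc

theorem commutator_closure_eq_closure_conjSeq (ha : a ^ 6 = 1) (hab : a * b ^ 2 = b * a ^ 2)
    (hac : a * c ^ 2 = c * a ^ 2) :
    ⁅Subgroup.closure {a, b, c}, Subgroup.closure {a, b, c}⁆ =
      Subgroup.closure {conjSeq a b 0, conjSeq a b 1, conjSeq a c 0, conjSeq a c 1} := by
  set H := Subgroup.closure {conjSeq a b 0, conjSeq a b 1, conjSeq a c 0, conjSeq a c 1} with hH
  have hb0 : conjSeq a b 0 ∈ H := Subgroup.subset_closure (by simp)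
  have hb1 : conjSeq a b 1 ∈ H := Subgroup.subset_closure (by simp)
  have hc0 : conjSeq a c 0 ∈ H := Subgroup.subset_closure (by simp)
  have hc1 : conjSeq a c 1 ∈ H := Subgroup.subset_closure (by simp)
  have step : ∀ {b}, a * b ^ 2 = b * a ^ 2 → conjSeq a b 0 ∈ H → conjSeq a b 1 ∈ H →
      conjSeq a b 2 ∈ H := by
    intro b hab h0 h1
    have := mul_mem (inv_mem h1) h0
    rwa [conjSeq_fib hab 0, zero_add, zero_add, inv_mul_cancel_left] at this
  have hb2 := step hab hb0 hb1
  have hc2 := step hac hc0 hc1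
  refine le_antisymm ?_ ?_
  · have na : a ∈ Subgroup.normalizer (H : Set G) := by
      refine Subgroup.mem_normalizer_closure (n := 5) (by simp [ha]) ?_
      rintro _ (rfl | rfl | rfl | rfl)
      · exact ⟨_, hb1, semiconjBy_conjSeq a b 0⟩
      · exact ⟨_, hb2, semiconjBy_conjSeq a b 1⟩
      · exact ⟨_, hc1, semiconjBy_conjSeq a c 0⟩
      · exact ⟨_, hc2, semiconjBy_conjSeq a c 1⟩
    have gen : ∀ {b}, conjSeq a b 0 ∈ H → b ∈ Subgroup.normalizer (H : Set G) := by
      intro b h0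
      have := mul_mem na (Subgroup.le_normalizer h0)
      rwa [conjSeq_zero, mul_inv_cancel_left] at this
    have ab : ∀ {b}, conjSeq a b 1 ∈ H → conjSeq a b 2 ∈ H → ⁅a, b⁆ ∈ H ∧ ⁅b, a⁆ ∈ H := by
      intro b h1 h2
      have : ⁅a, b⁆ ∈ H := by
        convert mul_mem h2 (inv_mem h1) using 1
        simp only [commutatorElement_def, conjSeq_one, conjSeq_two]
        group
      exact ⟨this, by simpa using inv_mem this⟩
    have bc : ⁅b, c⁆ ∈ H := by
      convert mul_mem (mul_mem (mul_mem hb1 hc2) (inv_mem hb2)) (inv_mem hc1) using 1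
      simp only [commutatorElement_def, conjSeq_one, conjSeq_two]
      group
    have cb : ⁅c, b⁆ ∈ H := by simpa using inv_mem bc
    obtain ⟨hab1, hab2⟩ := ab hb1 hb2
    obtain ⟨hac1, hac2⟩ := ab hc1 hc2
    refine Subgroup.commutator_closure_le ?_ ?_
    · rintro _ (rfl | rfl | rfl)
      exacts [na, gen hb0, gen hc0]
    · rintro _ (rfl | rfl | rfl) _ (rfl | rfl | rfl) <;> first | assumption | simp
  · set K := Subgroup.closure {a, b, c} with hK
    have ka : a ∈ K := Subgroup.subset_closure (by simp)
    have mem : ∀ {b}, a * b ^ 2 = b * a ^ 2 → b ∈ K → ∀ i, conjSeq a b i ∈ ⁅K, K⁆ := by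
      intro b hab kb i
      have h : conjSeq a b (i - 1) ∈ K :=
        mul_mem (mul_mem (zpow_mem ka _) kb) (inv_mem (zpow_mem ka _))
      have := Subgroup.commutator_mem_commutator h (pow_mem ka 2)
      have e : a ^ 2 * conjSeq a b (i - 1) * (a ^ 2)⁻¹ = conjSeq a b (i + 1) := by
        simp only [conjSeq]
        group
      have f := conjSeq_fib hab (i - 1)
      rw [sub_add_cancel, show i - 1 + 2 = i + 1 by ring] at f
      have e' : ⁅conjSeq a b (i - 1), a ^ 2⁆ =
          conjSeq a b (i - 1) * (a ^ 2 * conjSeq a b (i - 1) * (a ^ 2)⁻¹)⁻¹ := by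
        simp only [commutatorElement_def]
        group
      rwa [e', e, f, mul_inv_cancel_right] at this
    rw [hH, Subgroup.closure_le]
    have kb : b ∈ K := Subgroup.subset_closure (by simp)
    have kc : c ∈ K := Subgroup.subset_closure (by simp)
    rintro _ (rfl | rfl | rfl | rfl)
    exacts [mem hab kb 0, mem hab kb 1, mem hac kc 0, mem hac kc 1]

end ConjSeq

theorem Subgroup.nonempty_mulEquiv_of_basis_of_sq_mem {A : Type*} [CommGroup A] {n : ℕ}
    (b : Module.Basis (Fin n) ℤ (Additive A)) (K : Subgroup A) (hK : ∀ a, a ^ 2 ∈ K) :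
    Nonempty (K ≃* Multiplicative (Fin n → ℤ)) := by
  let K' : Submodule ℤ (Additive A) := AddSubgroup.toIntSubmodule K.toAddSubgroup
  have : Module.Free ℤ (Additive A) := .of_basis b
  have : Module.Finite ℤ (Additive A) := .of_basis b
  have hA : Module.finrank ℤ (Additive A) = n := by
    rw [Module.finrank_eq_card_basis b, Fintype.card_fin]
  let f : Additive A →ₗ[ℤ] K' := ((2 : ℤ) • LinearMap.id).codRestrict K' fun a => by
    have := hK a.toMul
    rw [← zpow_natCast] at this
    exact this
  have hf : Function.Injective f := by
    intro a a' h
    have : (2 : ℤ) • a = (2 : ℤ) • a' := congrArg Subtype.val h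
    exact smul_right_injective _ two_ne_zero this
  have hK' : Module.finrank ℤ K' = n := by
    refine le_antisymm (hA ▸ Submodule.finrank_le K') ?_
    exact hA ▸ LinearMap.finrank_le_finrank_of_injective hf
  let e := (Module.finBasisOfFinrankEq ℤ K' hK').equivFun
  exact ⟨e.toAddEquiv.toMultiplicative⟩

section Translation

/-- The group of translations of `ℤ³`, as permutations. -/
def translation : Multiplicative (ℤ × ℤ × ℤ) →* Equiv.Perm (ℤ × ℤ × ℤ) where
  toFun v := Equiv.addLeft v.toAdd
  map_one' := by simp
  map_mul' v w := by simp

theorem translation_apply (v p : ℤ × ℤ × ℤ) : translation (.ofAdd v) p = v + p := rfl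

theorem sum_zsmul_eq_zero_of_prod_eq_one {G : Type*} [Group G]
    (f : G →* Equiv.Perm (ℤ × ℤ × ℤ)) {n : ℕ} {u : Fin n → G} {v : Fin n → ℤ × ℤ × ℤ}
    (huv : ∀ j, f (u j) = translation (.ofAdd (v j))) {m : Fin n → ℤ}
    (h : (List.ofFn fun j => u j ^ m j).prod = 1) : ∑ j, m j • v j = 0 := by
  have h1 := congrArg f h
  have h2 : ∀ j, f (u j ^ m j) = translation (.ofAdd (m j • v j)) := by
    intro j
    rw [map_zpow, huv, ← map_zpow, ofAdd_zsmul]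
  rw [map_list_prod, map_one, List.map_ofFn] at h1
  have h3 : (f ∘ fun j => u j ^ m j) =
      translation ∘ fun j => Multiplicative.ofAdd (m j • v j) := funext h2
  rw [h3, ← List.map_ofFn, ← map_list_prod, List.prod_ofFn, ← ofAdd_sum] at h1
  have h4 := Equiv.congr_fun h1 0
  rwa [translation_apply, add_zero, Equiv.Perm.one_apply] at h4

/-- The first of two isometries of `ℤ³` satisfying the relations of `G3`. -/
def rotA : Equiv.Perm (ℤ × ℤ × ℤ) where
  toFun p := (-p.2.2, -p.1, -p.2.1)
  invFun p := (-p.2.1, -p.2.2, -p.1)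
  left_inv p := by simp
  right_inv p := by simp

/-- The second of two isometries of `ℤ³` satisfying the relations of `G3`. -/
def rotB : Equiv.Perm (ℤ × ℤ × ℤ) where
  toFun p := (p.2.2, -p.1 - 1, p.2.1 + 1)
  invFun p := (-p.2.1 - 1, p.2.2 - 1, p.1)
  left_inv p := by simp
  right_inv p := by simp

theorem rotA_apply (p : ℤ × ℤ × ℤ) : rotA p = (-p.2.2, -p.1, -p.2.1) := rfl

theorem rotB_apply (p : ℤ × ℤ × ℤ) : rotB p = (p.2.2, -p.1 - 1, p.2.1 + 1) := rfl

theorem rotA_symm_apply (p : ℤ × ℤ × ℤ) : rotA.symm p = (-p.2.1, -p.2.2, -p.1) := rfl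

theorem rotA_pow_six : rotA ^ 6 = 1 := by
  ext p <;> simp [pow_succ, rotA_apply]

theorem rotB_pow_six : rotB ^ 6 = 1 := by
  ext p <;> simp [pow_succ, rotB_apply]

theorem rotA_mul_rotB_sq : rotA * rotB ^ 2 = rotB * rotA ^ 2 := by
  ext p <;> simp [pow_succ, rotA_apply, rotB_apply] <;> ring

theorem conjSeq_rot_zero_apply (p : ℤ × ℤ × ℤ) :
    conjSeq rotA rotB 0 p = (p.1 + 1, -p.2.1 - 1, -p.2.2) := by
  rw [conjSeq_zero]
  ext <;> simp [rotA_symm_apply, rotB_apply] <;> ring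

theorem conjSeq_rot_one_apply (p : ℤ × ℤ × ℤ) :
    conjSeq rotA rotB 1 p = (-p.1, p.2.1 - 1, 1 - p.2.2) := by
  rw [conjSeq_one]
  ext <;> simp [rotA_symm_apply, rotB_apply]
  ring

theorem conjSeq_rot_zero_symm_apply (p : ℤ × ℤ × ℤ) :
    (conjSeq rotA rotB 0).symm p = (p.1 - 1, -p.2.1 - 1, -p.2.2) := by
  rw [Equiv.symm_apply_eq, conjSeq_rot_zero_apply]
  simp

theorem conjSeq_rot_one_symm_apply (p : ℤ × ℤ × ℤ) :
    (conjSeq rotA rotB 1).symm p = (-p.1, p.2.1 + 1, 1 - p.2.2) := by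
  rw [Equiv.symm_apply_eq, conjSeq_rot_one_apply]
  simp

theorem conjSeq_rot_neg_one :
    conjSeq rotA rotB (-1) = conjSeq rotA rotB 0 * conjSeq rotA rotB 1 := by
  simpa using conjSeq_fib rotA_mul_rotB_sq (-1)

theorem conjSeq_rot_two :
    conjSeq rotA rotB 2 = (conjSeq rotA rotB 1)⁻¹ * conjSeq rotA rotB 0 := by
  rw [conjSeq_fib rotA_mul_rotB_sq 0, zero_add, zero_add, inv_mul_cancel_left]

theorem conjSeq_rot_neg_one_sq :
    conjSeq rotA rotB (-1) ^ 2 = translation (.ofAdd (0, 0, -2)) := by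
  rw [conjSeq_rot_neg_one]
  ext p <;> simp [pow_two, conjSeq_rot_zero_apply, conjSeq_rot_one_apply, translation_apply] 
  ring

theorem conjSeq_rot_zero_sq : conjSeq rotA rotB 0 ^ 2 = translation (.ofAdd (2, 0, 0)) := by
  ext p <;> simp [pow_two, conjSeq_rot_zero_apply, translation_apply] 
  ring

theorem conjSeq_rot_one_sq : conjSeq rotA rotB 1 ^ 2 = translation (.ofAdd (0, -2, 0)) := by
  ext p <;> simp [pow_two, conjSeq_rot_one_apply, translation_apply] 
  ring

theorem twist_rot :
    IsFibPair.twist (conjSeq rotA rotB) (conjSeq rotA rotB) 0 =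
      translation (.ofAdd (-2, 2, -2)) := by
  ext p <;> simp [IsFibPair.twist, conjSeq_rot_zero_apply, conjSeq_rot_one_apply,
    conjSeq_rot_zero_symm_apply, conjSeq_rot_one_symm_apply, translation_apply] <;> ring

theorem shear_rot_zero :
    IsFibPair.shear (conjSeq rotA rotB) (conjSeq rotA rotB) 0 =
      translation (.ofAdd (-4, 0, 0)) := by
  ext p <;> simp [IsFibPair.shear, pow_two, conjSeq_rot_zero_apply, conjSeq_rot_one_apply,
    conjSeq_rot_zero_symm_apply, conjSeq_rot_one_symm_apply, translation_apply]
  ring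

theorem shear_rot_one :
    IsFibPair.shear (conjSeq rotA rotB) (conjSeq rotA rotB) 1 =
      translation (.ofAdd (0, 4, 0)) := by
  ext p <;> simp [IsFibPair.shear, pow_two, one_add_one_eq_two, conjSeq_rot_two,
    conjSeq_rot_zero_apply, conjSeq_rot_one_apply,
    conjSeq_rot_zero_symm_apply, conjSeq_rot_one_symm_apply, translation_apply]
  ring

end Translation

namespace IsFibPair

variable {G G' : Type*} [Group G] [Group G']

theorem map_latticeGen (f : G →* G') (x y : ℤ → G) (j : Fin 9) :
    f (latticeGen x y j) = latticeGen (fun i => f (x i)) (fun i => f (y i)) j := by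
  fin_cases j <;> simp [latticeGen, twist, shear]

end IsFibPair

open scoped IsMulCommutative

namespace G3

/-- The homomorphism from `G3` determined by three elements satisfying the defining relations. -/
def lift {G : Type*} [Group G] (u v w : G) (hu : u ^ 6 = 1) (hv : v ^ 6 = 1) (hw : w ^ 6 = 1)
    (huv : u * v ^ 2 = v * u ^ 2) (huw : u * w ^ 2 = w * u ^ 2) (hvw : v * w ^ 2 = w * v ^ 2) :
    G3 →* G :=
  PresentedGroup.toGroup (f := ![u, v, w]) (by
    rintro _ (rfl | rfl | rfl | rfl | rfl | rfl) <;> simp [*])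

/-- The `i`-th of the standard generators of `G3`. -/
abbrev gen (i : Fin 3) : G3 := PresentedGroup.of i

theorem gen_pow_six (i : Fin 3) : gen i ^ 6 = 1 :=
  PresentedGroup.one_of_mem (rels := G3rels) (x := FreeGroup.of i ^ 6) (by
    fin_cases i <;> simp [G3rels])

theorem gen_mul_gen_sq {i j : Fin 3} (hij : i < j) : gen i * gen j ^ 2 = gen j * gen i ^ 2 :=
  PresentedGroup.mk_eq_mk_of_mul_inv_mem (rels := G3rels)
    (x := FreeGroup.of i * FreeGroup.of j ^ 2) (y := FreeGroup.of j * FreeGroup.of i ^ 2) (by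
    fin_cases i <;> fin_cases j <;> simp_all [G3rels])

theorem closure_gen : Subgroup.closure {gen 0, gen 1, gen 2} = ⊤ := by
  rw [← PresentedGroup.closure_range_of G3rels]
  congr 1
  ext g
  simp [Fin.exists_fin_succ, eq_comm]

/-- The lattice of translations in `G3`. -/
abbrev lattice : Subgroup G3 :=
  IsFibPair.lattice (conjSeq (gen 0) (gen 1)) (conjSeq (gen 0) (gen 2))

theorem isFibPair : IsFibPair (conjSeq (gen 0) (gen 1)) (conjSeq (gen 0) (gen 2)) :=
  isFibPair_conjSeq (gen_pow_six 0) (gen_mul_gen_sq (by decide)) (gen_mul_gen_sq (by decide))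
    (gen_mul_gen_sq (by decide))

instance : IsMulCommutative lattice := isFibPair.lattice_isMulCommutative

theorem derivedSeries_two : derivedSeries G3 2 =
    ⁅Subgroup.closure {conjSeq (gen 0) (gen 1) 0, conjSeq (gen 0) (gen 1) 1,
        conjSeq (gen 0) (gen 2) 0, conjSeq (gen 0) (gen 2) 1},
      Subgroup.closure {conjSeq (gen 0) (gen 1) 0, conjSeq (gen 0) (gen 1) 1,
        conjSeq (gen 0) (gen 2) 0, conjSeq (gen 0) (gen 2) 1}⁆ := by
  rw [derivedSeries_succ, derivedSeries_succ, derivedSeries_zero, ← closure_gen,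
    commutator_closure_eq_closure_conjSeq (gen_pow_six 0) (gen_mul_gen_sq (by decide))
      (gen_mul_gen_sq (by decide))]

theorem derivedSeries_two_le : derivedSeries G3 2 ≤ lattice :=
  derivedSeries_two ▸ isFibPair.commutator_le_lattice

theorem sq_mem_derivedSeries_two {g : G3} (hg : g ∈ lattice) : g ^ 2 ∈ derivedSeries G3 2 :=
  derivedSeries_two ▸ isFibPair.sq_mem_commutator hg

theorem eq_zero_of_prod_latticeGen_eq_one {m : Fin 9 → ℤ}
    (h : (List.ofFn fun j => IsFibPair.latticeGen (conjSeq (gen 0) (gen 1))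
      (conjSeq (gen 0) (gen 2)) j ^ m j).prod = 1) : m = 0 := by
  have hA := rotA_pow_six
  have hB := rotB_pow_six
  have hAB := rotA_mul_rotB_sq
  have h1 := sum_zsmul_eq_zero_of_prod_eq_one (lift rotA rotB rotA hA hB hA hAB rfl hAB.symm)
    (v := ![(0, 0, -2), (2, 0, 0), (0, -2, 0), 0, 0, 0, 0, 0, 0]) (fun j => by
      simp only [IsFibPair.map_latticeGen, map_conjSeq]
      fin_cases j <;> simp [lift, IsFibPair.latticeGen, IsFibPair.twist, IsFibPair.shear,
        conjSeq_self, conjSeq_rot_neg_one_sq, conjSeq_rot_zero_sq, conjSeq_rot_one_sq]) h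
  have h2 := sum_zsmul_eq_zero_of_prod_eq_one (lift rotA rotA rotB hA hA hB rfl hAB hAB)
    (v := ![0, 0, 0, (0, 0, -2), (2, 0, 0), (0, -2, 0), 0, 0, 0]) (fun j => by
      simp only [IsFibPair.map_latticeGen, map_conjSeq]
      fin_cases j <;> simp [lift, IsFibPair.latticeGen, IsFibPair.twist, IsFibPair.shear,
        conjSeq_self, conjSeq_rot_neg_one_sq, conjSeq_rot_zero_sq, conjSeq_rot_one_sq]) h
  have h3 := sum_zsmul_eq_zero_of_prod_eq_one (lift rotA rotB rotB hA hB hB hAB hAB rfl)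
    (v := ![(0, 0, -2), (2, 0, 0), (0, -2, 0), (0, 0, -2), (2, 0, 0), (0, -2, 0),
      (-2, 2, -2), (-4, 0, 0), (0, 4, 0)]) (fun j => by
      simp only [IsFibPair.map_latticeGen, map_conjSeq]
      fin_cases j <;> simp [lift, IsFibPair.latticeGen, twist_rot, shear_rot_zero, shear_rot_one,
        conjSeq_rot_neg_one_sq, conjSeq_rot_zero_sq, conjSeq_rot_one_sq]) h
  simp [Fin.sum_univ_succ, Prod.ext_iff, -zsmul_eq_mul] at h1 h2 h3
  ext j
  fin_cases j <;> simp <;> omega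

/-- The normalised generators of the lattice of translations form a basis. -/
noncomputable def latticeBasis : Module.Basis (Fin 9) ℤ (Additive lattice) :=
  .mk (v := fun j => Additive.ofMul (⟨_, IsFibPair.latticeGen_mem _ _ j⟩ : lattice))
    (by
      rw [Fintype.linearIndependent_iff]
      intro m hm
      refine congrFun (eq_zero_of_prod_latticeGen_eq_one ?_)
      have h := congrArg (fun u : Additive lattice => lattice.subtype u.toMul) hm
      simpa [← List.prod_ofFn, map_list_prod, List.map_ofFn, Function.comp_def] using h)
    (by
      rintro ⟨g, hg⟩ -
      induction hg using Subgroup.closure_induction with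
      | mem g hg =>
        obtain ⟨j, rfl⟩ := hg
        exact Submodule.subset_span ⟨j, rfl⟩
      | one => exact Submodule.zero_mem _
      | mul g g' hg hg' h h' => exact Submodule.add_mem _ h h'
      | inv g hg h => exact Submodule.neg_mem _ h)

end G3

/-- The second derived subgroup of G(3) is free abelian of rank 9, and G(3) is
soluble of derived length exactly 3. -/
theorem second_derived_G3_free_abelian_rank_nine :
    Nonempty ((derivedSeries G3 2) ≃* Multiplicative (Fin 9 → ℤ)) ∧
    derivedSeries G3 3 = ⊥ ∧ derivedSeries G3 2 ≠ ⊥ := by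
  have hle := G3.derivedSeries_two_le
  have hiso : Nonempty ((derivedSeries G3 2) ≃* Multiplicative (Fin 9 → ℤ)) := by
    obtain ⟨e⟩ := Subgroup.nonempty_mulEquiv_of_basis_of_sq_mem G3.latticeBasis
      ((derivedSeries G3 2).subgroupOf G3.lattice)
      fun a => G3.sq_mem_derivedSeries_two a.2
    exact ⟨(Subgroup.subgroupOfEquivOfLe hle).symm.trans e⟩
  refine ⟨hiso, ?_, fun h => ?_⟩
  · rw [derivedSeries_succ, eq_bot_iff, Subgroup.commutator_le]
    intro g hg g' hg'
    rw [Subgroup.mem_bot, commutatorElement_eq_one_iff_mul_comm]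
    exact setLike_mul_comm (hle hg) (hle hg')
  · obtain ⟨e⟩ := hiso
    rw [h] at e
    exact not_subsingleton (Multiplicative (Fin 9 → ℤ)) e.symm.toEquiv.subsingleton
end

section
/- The group with presentation ⟨a, b | a^3 = 1, b^5 = 1, (aba^{-1}b^{-1}ab^2)^2 = 1, (ab)^5 = 1, [a,b]^3 = 1⟩ is finite of order 1920. -/
/-- The relators (with (ab)⁵ = 1 and [a,b]³ = 1 added) of ⟨a, b | a^3 = b^5 = (aba⁻¹b⁻¹ab²)² = 1, (ab)⁵ = 1, [a,b]³ = 1⟩. -/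
def Trels : Set (FreeGroup (Fin 2)) :=
  {(FreeGroup.of 0) ^ 3, (FreeGroup.of 1) ^ 5,
   (FreeGroup.of 0 * FreeGroup.of 1 * (FreeGroup.of 0)⁻¹ * (FreeGroup.of 1)⁻¹ *
     FreeGroup.of 0 * (FreeGroup.of 1) ^ 2) ^ 2,
   (FreeGroup.of 0 * FreeGroup.of 1) ^ 5,
   ((FreeGroup.of 0)⁻¹ * (FreeGroup.of 1)⁻¹ * FreeGroup.of 0 * FreeGroup.of 1) ^ 3}

/-- The corresponding presented group. -/
abbrev T : Type := PresentedGroup Trels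

namespace CosetEnumeration

/-! A Todd–Coxeter coset enumeration for groups with two generators, evaluated in the kernel.
Cosets are named by words applied to a base point. -/

/-- The generators `a`, `b` and their formal inverses `A`, `B`. -/
inductive Letter
  | a | A | b | B

namespace Letter

def inv : Letter → Letter
  | a => A | A => a | b => B | B => b

def beq : Letter → Letter → Bool
  | a, a | A, A | b, b | B, B => true
  | _, _ => false

theorem eq_of_beq {g h : Letter} (H : g.beq h = true) : g = h := by
  cases g <;> cases h <;> first | rfl | cases H

def all : List Letter := [a, A, b, B]

theorem mem_all (g : Letter) : g ∈ all := by
  cases g <;> simp [all]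

/-- The value of a letter, given the values of the two generators. -/
def eval {G : Type*} [Group G] (x y : G) : Letter → G
  | a => x | A => x⁻¹ | b => y | B => y⁻¹

theorem eval_inv {G : Type*} [Group G] (x y : G) (g : Letter) :
    g.inv.eval x y = (g.eval x y)⁻¹ := by
  cases g <;> simp [eval, inv]

end Letter

abbrev Word := List Letter

namespace Word

def invert (w : Word) : Word := (w.map Letter.inv).reverse

def beq : Word → Word → Bool
  | [], [] => true
  | g :: v, h :: w => match g.beq h with
    | true => beq v w
    | false => false
  | _, _ => false

theorem eq_of_beq : ∀ {v w : Word}, beq v w = true → v = w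
  | [], [], _ => rfl
  | g :: v, h :: w, H => by
    cases hgh : g.beq h with
    | true =>
      simp only [beq, hgh] at H
      rw [Letter.eq_of_beq hgh, eq_of_beq H]
    | false => simp [beq, hgh] at H

end Word

/-- What a coset table knows about a word: nothing, that it names a coset, or that it names the
same coset as another word. -/
inductive Entry
  | undefined | live | equal (w : Word)

/-- A coset table, as a trie indexed by words. -/
inductive Table
  | nil
  | node (e : Entry) (ta tA tb tB : Table)

namespace Table

/- `find` and `resolve` are written with recursors because these reduce faster in the kernel. -/

noncomputable def find (t : Table) : Word → Entry :=
  t.rec (fun _ => .undefined) fun e _ _ _ _ fa fA fb fB w =>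
    w.casesOn e fun g w => g.casesOn (fa w) (fA w) (fb w) (fB w)

def set (e : Entry) : Word → Table → Table
  | [], nil => node e nil nil nil nil
  | [], node _ ta tA tb tB => node e ta tA tb tB
  | .a :: w, nil => node .undefined (set e w nil) nil nil nil
  | .A :: w, nil => node .undefined nil (set e w nil) nil nil
  | .b :: w, nil => node .undefined nil nil (set e w nil) nil
  | .B :: w, nil => node .undefined nil nil nil (set e w nil)
  | .a :: w, node e₀ ta tA tb tB => node e₀ (set e w ta) tA tb tB
  | .A :: w, node e₀ ta tA tb tB => node e₀ ta (set e w tA) tb tB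
  | .b :: w, node e₀ ta tA tb tB => node e₀ ta tA (set e w tb) tB
  | .B :: w, node e₀ ta tA tb tB => node e₀ ta tA tb (set e w tB)

/-- The words naming cosets. -/
def lives : Table → List Word
  | nil => []
  | node e ta tA tb tB =>
    (match e with | .live => [[]] | _ => []) ++
      (ta.lives.map (.a :: ·) ++ (tA.lives.map (.A :: ·) ++
        (tb.lives.map (.b :: ·) ++ tB.lives.map (.B :: ·))))

/-- The words of length `n` naming cosets. -/
def livesAt : ℕ → Table → List Word
  | _, nil => []
  | 0, node .live _ _ _ _ => [[]]
  | 0, node _ _ _ _ _ => []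
  | n + 1, node _ ta tA tb tB =>
    (livesAt n ta).map (.a :: ·) ++ ((livesAt n tA).map (.A :: ·) ++
      ((livesAt n tb).map (.b :: ·) ++ (livesAt n tB).map (.B :: ·)))

/-- Follow at most `n` equalities to find the name of the coset of a word. -/
noncomputable def resolve (t : Table) (n : ℕ) : Word → Option Word :=
  n.rec (fun _ => none) fun _ f w => (t.find w).casesOn none (some w) f

noncomputable def get (t : Table) (w : Word) : Option Word := resolve t 100 w

/-- Record that the letter `g` sends the coset `c` to the coset `d`. -/
noncomputable def link (merge : Table → Word → Word → Table) (t : Table) (c : Word) (g : Letter)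
    (d : Word) : Table :=
  match t.get c, t.get d with
  | some c, some d => match t.get (g :: c) with
    | none => match t.get (g.inv :: d) with
      | none => (t.set (.equal d) (g :: c)).set (.equal c) (g.inv :: d)
      | some z => merge (t.set (.equal d) (g :: c)) z c
    | some z => merge t z d
  | _, _ => t

/-- Copy the image of `y` under `g` to `x`. -/
noncomputable def transfer (merge : Table → Word → Word → Table) (x y : Word) (t : Table)
    (g : Letter) : Table :=
  match t.get (g :: y) with
  | none => t
  | some d => link merge t x g d

/-- Drop the name `y` of a coset also named `x`. -/
noncomputable def absorb (merge : Table → Word → Word → Table) (t : Table) (x y : Word) : Table :=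
  Letter.all.foldl (transfer merge x y) (t.set (.equal x) y)

/-- Process the coincidence of the cosets of `x` and `y`, with recursion depth at most `n`. -/
noncomputable def merge : ℕ → Table → Word → Word → Table
  | 0, t, _, _ => t
  | n + 1, t, x, y => match t.get x, t.get y with
    | some x, some y => match Word.beq x y with
      | true => t
      | false => match Nat.ble x.length y.length with
        | true => absorb (merge n) t x y
        | false => absorb (merge n) t y x
    | _, _ => t

/-- Apply the letters of a word to a coset, from the left end of the word, as long as the images
are defined; return the last coset and the rest of the word. -/
noncomputable def walk (t : Table) : Word → Word → Word × Word
  | c, [] => (c, [])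
  | c, g :: w => match t.get (g :: c) with
    | none => (c, g :: w)
    | some d => walk t d w

/-- Record that the word `w` leads from `c` to `b`, defining the cosets in between. -/
noncomputable def close (n : ℕ) (b : Word) : Table → Word → Word → Table
  | t, c, [] => merge n t c b
  | t, c, [g] => link (merge n) t c g b
  | t, c, g :: w => close n b ((t.set .live (g :: c)).set (.equal c) (g.inv :: g :: c)) (g :: c) w

/-- Record that the relator `r` fixes the coset `c`. -/
noncomputable def scan (n : ℕ) (c : Word) (t : Table) (r : Word) : Table :=
  match t.find c with
  | .live => match walk t c r with
    | (f, r) => match walk t c (Word.invert r) with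
      | (b, s) => close n b t f (Word.invert s)
  | _ => t

/-- Scan all relators at all cosets named by words of length less than `n`. -/
noncomputable def enumerate (rels : List Word) (t : Table) (n : ℕ) : Table :=
  (List.range n).foldl
    (fun t k => (livesAt k t).foldl (fun t c => rels.foldl (scan 200 c) t) t) t

/-- The table has at most `n` cosets, and the letters act on them. -/
noncomputable def isComplete (t : Table) (n : ℕ) : Bool :=
  match Nat.ble t.lives.length n with
  | true => (t.get []).isSome && t.lives.all fun c => Letter.all.all fun g => (t.get (g :: c)).isSome
  | false => false

theorem find_set (e : Entry) (w : Word) (t : Table) (v : Word) :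
    (v = w ∧ (t.set e w).find v = e) ∨ (t.set e w).find v = t.find v := by
  induction w generalizing t v with
  | nil => cases t <;> rcases v with _ | ⟨⟨⟩, v⟩ <;> simp [set, find]
  | cons g w ih =>
    cases t <;> rcases v with _ | ⟨⟨⟩, v⟩ <;> cases g <;>
      first | exact .inr rfl | exact (ih _ v).imp (fun h => ⟨congrArg _ h.1, h.2⟩) id

theorem mem_lives {t : Table} {w : Word} (h : t.find w = .live) : w ∈ t.lives := by
  induction t generalizing w with
  | nil => cases h
  | node e ta tA tb tB ia iA ib iB =>
    rcases w with _ | ⟨⟨⟩, w⟩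
    · obtain rfl : e = .live := h
      simp [lives]
    · simpa [lives] using .inr (ia h)
    · simpa [lives] using .inr (iA h)
    · simpa [lives] using .inr (ib h)
    · simpa [lives] using .inr (iB h)

theorem resolve_succ (t : Table) (n : ℕ) (w : Word) :
    t.resolve (n + 1) w = match t.find w with
      | .undefined => none
      | .live => some w
      | .equal v => t.resolve n v := by
  cases h : t.find w <;> simp [resolve, h]

theorem find_get {t : Table} {v w : Word} (h : t.get w = some v) : t.find v = .live := by
  suffices ∀ n w, t.resolve n w = some v → t.find v = .live from this _ _ h
  intro n
  induction n with
  | zero => intro w h; cases h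
  | succ n ih =>
    intro w h
    rw [resolve_succ] at h
    split at h
    · cases h
    · next hw => cases h; exact hw
    · exact ih _ h

section Soundness

variable {G X : Type*} [Group G] [MulAction G X] {x y : G} {p : X}

variable (x y p) in
/-- The point reached from the base point `p`. -/
def point : Word → X
  | [] => p
  | g :: w => g.eval x y • point w

variable (x y) in
/-- Apply the letters of a word to a point, from the left end of the word. -/
def act : Word → X → X
  | [], q => q
  | g :: w, q => act w (g.eval x y • q)

variable (x y p) in
/-- The equalities in the table hold. -/
def IsSound (t : Table) : Prop :=
  ∀ v w, t.find w = .equal v → point x y p w = point x y p v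

theorem act_append (v w : Word) (q : X) : act x y (v ++ w) q = act x y w (act x y v q) := by
  induction v generalizing q with
  | nil => rfl
  | cons g v ih => exact ih _

theorem act_invert (w : Word) (q : X) : act x y (Word.invert w) (act x y w q) = q := by
  induction w generalizing q with
  | nil => rfl
  | cons g w ih =>
    have : Word.invert (g :: w) = Word.invert w ++ [g.inv] := by simp [Word.invert]
    rw [this, act_append]
    change g.inv.eval x y • act x y (Word.invert w) (act x y w (g.eval x y • q)) = q
    rw [ih, Letter.eval_inv, inv_smul_smul]

theorem IsSound.nil : IsSound x y p nil := fun _ _ h => by cases h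

theorem IsSound.set_live {t : Table} (h : IsSound x y p t) (w : Word) :
    IsSound x y p (t.set .live w) := by
  intro u v huv
  obtain ⟨-, h'⟩ | h' := find_set .live w t v
  · cases h'.symm.trans huv
  · exact h u v (h'.symm.trans huv)

theorem IsSound.set_equal {t : Table} (h : IsSound x y p t) {v w : Word}
    (hvw : point x y p w = point x y p v) : IsSound x y p (t.set (.equal v) w) := by
  intro u v' huv
  obtain ⟨rfl, h'⟩ | h' := find_set (.equal v) w t v'
  · cases h'.symm.trans huv
    exact hvw
  · exact h u v' (h'.symm.trans huv)

theorem IsSound.get {t : Table} (h : IsSound x y p t) {v w : Word} (hvw : t.get w = some v) :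
    point x y p w = point x y p v := by
  suffices ∀ n w, t.resolve n w = some v → point x y p w = point x y p v from this _ _ hvw
  intro n
  induction n with
  | zero => intro w h; cases h
  | succ n ih =>
    intro w hw
    rw [resolve_succ] at hw
    split at hw
    · cases hw
    · cases hw; rfl
    · next hv => exact (h _ _ hv).trans (ih _ hw)

variable {m : Table → Word → Word → Table}

theorem IsSound.link
    (hm : ∀ t, IsSound x y p t → ∀ v w, point x y p v = point x y p w → IsSound x y p (m t v w))
    {t : Table} (h : IsSound x y p t) {c d : Word} {g : Letter}
    (hcd : g.eval x y • point x y p c = point x y p d) : IsSound x y p (link m t c g d) := by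
  unfold Table.link
  split
  · next c' d' hc hd =>
    rw [h.get hc, h.get hd] at hcd
    change point x y p (g :: c') = _ at hcd
    have hcd' : point x y p (g.inv :: d') = point x y p c' := by
      rw [point, ← hcd, point, Letter.eval_inv, inv_smul_smul]
    split
    · split
      · exact (h.set_equal hcd).set_equal hcd'
      · next hz => exact hm _ (h.set_equal hcd) _ _ ((h.get hz).symm.trans hcd')
    · next hz => exact hm _ h _ _ ((h.get hz).symm.trans hcd)
  · exact h

theorem IsSound.transfer
    (hm : ∀ t, IsSound x y p t → ∀ v w, point x y p v = point x y p w → IsSound x y p (m t v w))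
    {t : Table} (h : IsSound x y p t) {v w : Word} (hvw : point x y p v = point x y p w)
    (g : Letter) : IsSound x y p (transfer m v w t g) := by
  unfold Table.transfer
  split
  · exact h
  · next hd => exact h.link hm (by rw [hvw]; exact h.get hd)

theorem IsSound.foldl {α : Type*} {f : Table → α → Table} {l : List α}
    (hf : ∀ t, IsSound x y p t → ∀ i ∈ l, IsSound x y p (f t i)) {t : Table}
    (h : IsSound x y p t) : IsSound x y p (l.foldl f t) := by
  induction l generalizing t with
  | nil => exact h
  | cons i l ih =>
    exact ih (fun t ht j hj => hf t ht j (.tail _ hj)) (hf t h i (.head _))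

theorem IsSound.absorb
    (hm : ∀ t, IsSound x y p t → ∀ v w, point x y p v = point x y p w → IsSound x y p (m t v w))
    {t : Table} (h : IsSound x y p t) {v w : Word} (hvw : point x y p v = point x y p w) :
    IsSound x y p (absorb m t v w) :=
  .foldl (fun _ ht g _ => ht.transfer hm hvw g) (h.set_equal hvw.symm)

theorem IsSound.merge (n : ℕ) : ∀ t, IsSound x y p t → ∀ v w, point x y p v = point x y p w →
    IsSound x y p (merge n t v w) := by
  induction n with
  | zero => exact fun t h _ _ _ => h
  | succ n ih =>
    intro t h v w hvw
    unfold Table.merge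
    split
    · next hv hw =>
      rw [h.get hv, h.get hw] at hvw
      split
      · exact h
      · split
        · exact h.absorb ih hvw
        · exact h.absorb ih hvw.symm
    · exact h

theorem IsSound.walk {t : Table} (h : IsSound x y p t) (c w : Word) :
    act x y (walk t c w).2 (point x y p (walk t c w).1) = act x y w (point x y p c) := by
  induction w generalizing c with
  | nil => rfl
  | cons g w ih =>
    unfold Table.walk
    split
    · rfl
    · next hd => rw [ih, ← h.get hd]; rfl

theorem IsSound.close (n : ℕ) {b : Word} {t : Table} (h : IsSound x y p t) {c w : Word}
    (hw : act x y w (point x y p c) = point x y p b) : IsSound x y p (close n b t c w) := by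
  induction w generalizing c t with
  | nil => exact h.merge n _ _ _ hw
  | cons g w ih =>
    cases w with
    | nil => exact h.link (IsSound.merge n) hw
    | cons g' w =>
      refine ih ((h.set_live _).set_equal ?_) hw
      rw [point, point, Letter.eval_inv, inv_smul_smul]

theorem IsSound.scan (n : ℕ) {t : Table} (h : IsSound x y p t) (c : Word) {r : Word}
    (hr : ∀ q : X, act x y r q = q) : IsSound x y p (scan n c t r) := by
  unfold Table.scan
  split
  · have hf := h.walk c r
    generalize Table.walk t c r = f at hf
    have hb := h.walk c (Word.invert f.2)
    refine h.close n ?_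
    generalize Table.walk t c (Word.invert f.2) = b at hb
    rw [hr] at hf
    rw [← hf, act_invert] at hb
    rw [← hb, act_invert]
  · exact h

theorem IsSound.enumerate {rels : List Word} (hr : ∀ r ∈ rels, ∀ q : X, act x y r q = q)
    {t : Table} (h : IsSound x y p t) (n : ℕ) : IsSound x y p (enumerate rels t n) :=
  .foldl (fun _ ht _ _ => .foldl (fun _ ht c _ =>
    .foldl (fun _ ht r hrr => ht.scan 200 c (hr r hrr)) ht) ht) h

/-- A complete sound table bounds the size of a set on which the group acts transitively. -/
theorem IsSound.card_le {t : Table} (h : IsSound x y p t) {n : ℕ} (hn : t.isComplete n = true)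
    (hxy : Subgroup.closure {x, y} = ⊤) [MulAction.IsPretransitive G X] :
    Finite X ∧ Nat.card X ≤ n := by
  unfold isComplete at hn
  split at hn
  swap
  · cases hn
  next hlen =>
  simp only [Bool.and_eq_true, List.all_eq_true] at hn
  obtain ⟨hp, hl⟩ := hn
  have mem_of_get {w : Word} (hw : (t.get w).isSome = true) :
      point x y p w ∈ t.lives.map (point x y p) := by
    obtain ⟨v, hv⟩ := Option.isSome_iff_exists.mp hw
    rw [h.get hv]
    exact List.mem_map_of_mem (mem_lives (find_get hv))
  have eval_smul_mem (g : Letter) {q : X} (hq : q ∈ t.lives.map (point x y p)) :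
      g.eval x y • q ∈ t.lives.map (point x y p) := by
    obtain ⟨c, hc, rfl⟩ := List.mem_map.mp hq
    exact mem_of_get (hl c hc g g.mem_all)
  have mem (q : X) : q ∈ t.lives.map (point x y p) := by
    obtain ⟨g, rfl⟩ := MulAction.exists_smul_eq G p q
    have hg : g ∈ Subgroup.closure {x, y} := hxy ▸ Subgroup.mem_top g
    induction hg using Subgroup.closure_induction_left with
    | one => simpa [point] using mem_of_get hp
    | mul_left u hu v _ ih =>
      rw [mul_smul]
      obtain rfl | rfl := hu
      · exact eval_smul_mem .a ih
      · exact eval_smul_mem .b ih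
    | inv_mul_cancel u hu v _ ih =>
      rw [mul_smul]
      obtain rfl | rfl := hu
      · exact eval_smul_mem .A ih
      · exact eval_smul_mem .B ih
  have hsurj : Function.Surjective (t.lives.map (point x y p)).get := fun q =>
    List.mem_iff_get.mp (mem q)
  refine ⟨.of_surjective _ hsurj, (Nat.card_le_card_of_surjective _ hsurj).trans ?_⟩
  simpa using Nat.le_of_ble_eq_true hlen

end Soundness

end Table

end CosetEnumeration

open CosetEnumeration

/-- A lower bound for the order of a group by the length of an orbit and the order of a point
stabilizer. -/
theorem length_mul_card_stabilizer_le {G α : Type*} [Group G] [Finite G] [MulAction G α]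
    (H : Subgroup G) (q : α) (l : List G) (hl : ∀ u ∈ l, u ∈ H) (hq : (l.map (· • q)).Nodup) :
    l.length * Nat.card ↥(H ⊓ MulAction.stabilizer G q) ≤ Nat.card H := by
  let f : Fin l.length × ↥(H ⊓ MulAction.stabilizer G q) → H := fun i =>
    ⟨l.get i.1 * i.2, H.mul_mem (hl _ (l.get_mem _)) i.2.2.1⟩
  have hf : Function.Injective f := by
    rintro ⟨i, u⟩ ⟨j, v⟩ huv
    have huv : l.get i * u = l.get j * v := congrArg Subtype.val huv
    have hij : l.get i • q = l.get j • q := by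
      have := congrArg (· • q) huv
      simpa only [mul_smul, MulAction.mem_stabilizer_iff.mp u.2.2,
        MulAction.mem_stabilizer_iff.mp v.2.2] using this
    obtain rfl : i = j := by
      have := List.nodup_iff_injective_get.mp hq
        (a₁ := i.cast (by simp)) (a₂ := j.cast (by simp)) (by simpa using hij)
      simpa [Fin.ext_iff] using this
    simpa using huv
  simpa using Nat.card_le_card_of_injective f hf

namespace T

def a : T := PresentedGroup.of 0

def b : T := PresentedGroup.of 1

theorem a_pow_three : a ^ 3 = 1 :=
  PresentedGroup.one_of_mem (rels := Trels) (.inl rfl)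

theorem b_pow_five : b ^ 5 = 1 :=
  PresentedGroup.one_of_mem (rels := Trels) (.inr (.inl rfl))

theorem involution : (a * b * a⁻¹ * b⁻¹ * a * b ^ 2) ^ 2 = 1 :=
  PresentedGroup.one_of_mem (rels := Trels) (.inr (.inr (.inl rfl)))

theorem ab_pow_five : (a * b) ^ 5 = 1 :=
  PresentedGroup.one_of_mem (rels := Trels) (.inr (.inr (.inr (.inl rfl))))

theorem commutator_pow_three : (a⁻¹ * b⁻¹ * a * b) ^ 3 = 1 :=
  PresentedGroup.one_of_mem (rels := Trels) (.inr (.inr (.inr (.inr rfl))))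

theorem closure_eq_top : Subgroup.closure {a, b} = ⊤ := by
  rw [← PresentedGroup.closure_range_of Trels]
  congr 1
  ext g
  simp [Fin.exists_fin_two, a, b, eq_comm]

/-- Cyclic conjugates of the relators or their inverses, to be read from right to left. -/
def relators : List Word :=
  [[.A, .A, .A], [.b, .b, .b, .b, .b],
    [.b, .a, .b, .a, .b, .a, .b, .a, .b, .a],
    [.B, .A, .b, .a, .B, .A, .b, .a, .B, .A, .b, .a],
    [.b, .b, .a, .B, .A, .b, .a, .b, .b, .a, .B, .A, .b, .a]]

theorem act_relators {X : Type*} [MulAction T X] :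
    ∀ r ∈ relators, ∀ q : X, Table.act a b r q = q := by
  have one_smul_of {u : T} (hu : u = 1) (q : X) : u • q = q := by rw [hu, one_smul]
  simp only [relators, List.forall_mem_cons, Table.act, Letter.eval, smul_smul]
  refine ⟨one_smul_of ?_, one_smul_of ?_, one_smul_of ?_, one_smul_of ?_, one_smul_of ?_,
    fun _ h => nomatch h⟩
  · rw [← inv_eq_one, ← a_pow_three]
    simp only [pow_succ, pow_zero, one_mul, mul_assoc, mul_inv_rev, inv_inv]
  · rw [← b_pow_five]; simp only [pow_succ, pow_zero, one_mul, mul_assoc]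
  · rw [← ab_pow_five]; simp only [pow_succ, pow_zero, one_mul, mul_assoc]
  · rw [← conj_eq_one_iff (a := a⁻¹ * b⁻¹), ← commutator_pow_three]
    simp only [pow_succ, pow_zero, one_mul, mul_assoc, mul_inv_rev, inv_inv, inv_mul_cancel_left,
      inv_mul_cancel, mul_one]
  · rw [← involution]; simp only [pow_succ, pow_zero, one_mul, mul_assoc]

/-- The table recording that `b` fixes the base point. -/
def start : Table :=
  ((Table.nil.set .live []).set (.equal []) [.B]).set (.equal []) [.b]

theorem isComplete_enumerate : (Table.enumerate relators start 10).isComplete 384 = true := by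
  decide +kernel

theorem card_quotient_le :
    Finite (T ⧸ Subgroup.zpowers b) ∧ Nat.card (T ⧸ Subgroup.zpowers b) ≤ 384 := by
  have hb : b • ((1 : T) : T ⧸ Subgroup.zpowers b) = (1 : T) := by
    rw [MulAction.Quotient.smul_coe, QuotientGroup.eq]
    simp
  have hb' : b⁻¹ • ((1 : T) : T ⧸ Subgroup.zpowers b) = (1 : T) := inv_smul_eq_iff.mpr hb.symm
  have hstart : start.IsSound a b ((1 : T) : T ⧸ Subgroup.zpowers b) :=
    .set_equal (.set_equal (.set_live .nil _) (v := []) (w := [.B]) hb') (v := []) (w := [.b]) hb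
  exact (hstart.enumerate act_relators 10).card_le isComplete_enumerate closure_eq_top

theorem finite_and_card_le : Finite T ∧ Nat.card T ≤ 1920 := by
  have hb : Nat.card (Subgroup.zpowers b) ≤ 5 := by
    rw [Nat.card_zpowers]
    exact orderOf_le_of_pow_eq_one (by norm_num) b_pow_five
  have : Finite (Subgroup.zpowers b) :=
    (isOfFinOrder_iff_pow_eq_one.mpr ⟨5, by norm_num, b_pow_five⟩).finite_zpowers
  obtain ⟨_, h⟩ := card_quotient_le
  refine ⟨.of_subgroup_quotient (Subgroup.zpowers b), ?_⟩
  rw [Subgroup.card_eq_card_quotient_mul_card_subgroup (Subgroup.zpowers b)]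
  exact Nat.mul_le_mul h hb

/-- The action of the generators on the twelve vectors `± eᵢ`, where `i` and `i + 6` stand for
opposite vectors. -/
def generatorPerm : Fin 2 → Equiv.Perm (Fin 12) :=
  ![c[0, 2, 1] * c[3, 10, 11] * c[4, 5, 9] * c[6, 8, 7], c[0, 4, 1, 2, 3] * c[6, 10, 7, 8, 9]]

theorem lift_generatorPerm : ∀ r ∈ Trels, FreeGroup.lift generatorPerm r = 1 := by
  rintro r (rfl | rfl | rfl | rfl | rfl) <;> simp only [map_mul, map_pow, map_inv,
    FreeGroup.lift_apply_of] <;> decide +kernel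

def perm : T →* Equiv.Perm (Fin 12) := PresentedGroup.toGroup lift_generatorPerm

def permWord (w : Word) : Equiv.Perm (Fin 12) :=
  (w.map (Letter.eval (generatorPerm 0) (generatorPerm 1))).prod

theorem permWord_mem_range (w : Word) : permWord w ∈ perm.range := by
  refine Subgroup.list_prod_mem _ fun u hu => ?_
  obtain ⟨g, -, rfl⟩ := List.mem_map.mp hu
  have h (i : Fin 2) : generatorPerm i ∈ perm.range :=
    ⟨PresentedGroup.of i, PresentedGroup.toGroup.of _⟩
  cases g
  exacts [h 0, inv_mem (h 0), h 1, inv_mem (h 1)]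

/-- The pointwise stabilizer of some of the twelve vectors in the image of `perm`. -/
def stab : List (Fin 12) → Subgroup (Equiv.Perm (Fin 12))
  | [] => perm.range
  | q :: l => stab l ⊓ MulAction.stabilizer _ q

theorem permWord_mem_stab (w : Word) :
    ∀ l : List (Fin 12), (∀ q ∈ l, permWord w q = q) → permWord w ∈ stab l
  | [], _ => permWord_mem_range w
  | _ :: l, h => ⟨permWord_mem_stab w l fun q hq => h q (.tail _ hq), h _ (.head _)⟩

theorem length_mul_card_stab_le (l : List (Fin 12)) (q : Fin 12) (ws : List Word)
    (h : (∀ w ∈ ws, ∀ q ∈ l, permWord w q = q) ∧ (ws.map (permWord · q)).Nodup) :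
    ws.length * Nat.card (stab (q :: l)) ≤ Nat.card (stab l) := by
  have := length_mul_card_stabilizer_le (stab l) q (ws.map permWord)
    (List.forall_mem_map.mpr fun w hw => permWord_mem_stab w l (h.1 w hw))
    (by rw [List.map_map]; exact h.2)
  rwa [List.length_map] at this

theorem card_range_perm : 1920 ≤ Nat.card perm.range := by
  have h₀ := length_mul_card_stab_le [] 0 [[], [.a], [.A], [.b], [.B], [.a, .b], [.A, .B],
    [.a, .B], [.A, .b], [.B, .A, .b], [.b, .A, .b], [.b, .a, .B]] (by decide +kernel)
  have h₁ := length_mul_card_stab_le [0] 1 [[], [.B, .B, .A], [.a, .b, .b], [.A, .b, .A],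
    [.b, .a, .b, .A, .B], [.B, .A, .B, .a, .b], [.B, .A, .b, .a, .b],
    [.a, .b, .b, .a, .b, .b], [.a, .b, .A, .b, .a, .b], [.b, .A, .b, .b, .A, .B, .A]]
    (by decide +kernel)
  have h₂ := length_mul_card_stab_le [1, 0] 2 [[], [.A, .B, .B], [.b, .b, .a],
    [.b, .b, .a, .b, .b, .a]] (by decide +kernel)
  have h₃ := length_mul_card_stab_le [2, 1, 0] 3 [[], [.a, .B, .a, .B, .A, .b, .b, .a, .b]]
    (by decide +kernel)
  have h₄ := length_mul_card_stab_le [3, 2, 1, 0] 4 [[], [.a, .b, .a, .b, .b, .A, .B, .a, .B]]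
    (by decide +kernel)
  have h₅ : 0 < Nat.card (stab [4, 3, 2, 1, 0]) := Nat.card_pos
  simp only [List.length_cons, List.length_nil] at h₀ h₁ h₂ h₃ h₄
  change 1920 ≤ Nat.card (stab [])
  omega

end T

/-- Adding the relations (ab)⁵ = 1 and [a,b]³ = 1 to the generalized triangle group
gives a finite group of order 1920. -/
theorem triangle_group_ab5_comm3_order : Nat.card T = 1920 := by
  obtain ⟨_, h⟩ := T.finite_and_card_le
  exact h.antisymm (T.card_range_perm.trans
    (Nat.card_le_card_of_surjective _ T.perm.rangeRestrict_surjective))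
end
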